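/- Each of the tetrominoes P₄,₁ = {(0,0),(0,1),(0,2),(0,3)} (the I-tetromino), P₄,₃ = {(0,0),(0,1),(1,1),(0,2)} (the T-tetromino) and P₄,₅ = {(0,0),(0,1),(1,1),(1,2)} (the S-tetromino) has threshold sequence (1,3,11,∞): each is a (1,1)-winner, a (1,2)-loser, a (2,3)-winner, a (2,4)-loser, a (3,11)-winner, a (3,12)-loser, and an (n,b)-winner for every n ≥ 4 and every b ∈ ℕ. -/

import Mathlib

/-- Cells of the square board. -/
abbrev Cell : Type := ℤ × ℤ

/-- Two cells are adjacent if they differ by `(±1,0)` or `(0,±1)`. -/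
def Adjacent (p q : Cell) : Prop :=
  (p.1 - q.1).natAbs + (p.2 - q.2).natAbs = 1

/-- A polyomino is a finite nonempty set of cells that is connected under adjacency. -/
def IsPolyomino (A : Finset Cell) : Prop :=
  A.Nonempty ∧ ∀ p ∈ A, ∀ q ∈ A,
    Relation.ReflTransGen (fun u v => u ∈ A ∧ v ∈ A ∧ Adjacent u v) p q

/-- A symmetry of the square lattice: a translation composed with a rotation by a
multiple of 90 degrees and possibly a reflection. -/
def IsSquareSymmetry (f : Cell → Cell) : Prop :=
  ∃ (e₁ e₂ : ℤ) (s : Bool) (t : Cell),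
    (e₁ = 1 ∨ e₁ = -1) ∧ (e₂ = 1 ∨ e₂ = -1) ∧
    ∀ p : Cell, f p =
      if s then (e₁ * p.2 + t.1, e₂ * p.1 + t.2)
      else (e₁ * p.1 + t.1, e₂ * p.2 + t.2)

/-- `P` is a placement of the polyomino `A`: the image of `A` under a symmetry
of the square lattice. -/
def IsPlacement (A : Finset Cell) (P : Set Cell) : Prop :=
  ∃ f : Cell → Cell, IsSquareSymmetry f ∧ P = f '' (↑A : Set Cell)

/-- The maker's move on his `n`-th turn (`0`-indexed), given his strategy `σ`
(a function of the list of the breaker's previous moves, which together with `σ`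
determines the whole history) and the breaker's sequence of moves `β`. -/
def makerMove (σ : List (Finset Cell) → Finset Cell) (β : ℕ → Finset Cell) (n : ℕ) :
    Finset Cell :=
  σ ((List.range n).map β)

/-- The set of cells marked by the maker after his first `n` turns. -/
def makerMarks (σ : List (Finset Cell) → Finset Cell) (β : ℕ → Finset Cell) :
    ℕ → Finset Cell
  | 0 => ∅
  | n + 1 => makerMarks σ β n ∪ makerMove σ β n

/-- The set of cells marked by the breaker after her first `n` turns. -/
def breakerMarks (β : ℕ → Finset Cell) : ℕ → Finset Cell
  | 0 => ∅
  | n + 1 => breakerMarks β n ∪ β n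

/-- The maker plays legally: on every turn he marks exactly `a` previously unmarked cells. -/
def MakerLegal (a : ℕ) (σ : List (Finset Cell) → Finset Cell) (β : ℕ → Finset Cell) : Prop :=
  ∀ n, (makerMove σ β n).card = a ∧
    Disjoint (makerMove σ β n) (makerMarks σ β n ∪ breakerMarks β n)

/-- The breaker plays legally: on every turn she marks exactly `b` previously unmarked
cells (on turn `n` she moves after the maker, so she must avoid `makerMarks σ β (n+1)`). -/
def BreakerLegal (b : ℕ) (σ : List (Finset Cell) → Finset Cell) (β : ℕ → Finset Cell) : Prop :=
  ∀ n, (β n).card = b ∧ Disjoint (β n) (makerMarks σ β (n + 1) ∪ breakerMarks β n)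

/-- `A` is an `(a,b)`-winner: the maker has a winning strategy in the weak `(a,b)`
achievement game with goal `A`, i.e. a strategy that always plays legally against any
legal breaker play and eventually marks all cells of some placement of `A`. -/
def IsWinner (A : Finset Cell) (a b : ℕ) : Prop :=
  ∃ σ : List (Finset Cell) → Finset Cell, ∀ β : ℕ → Finset Cell,
    BreakerLegal b σ β →
      MakerLegal a σ β ∧
        ∃ n, ∃ P : Set Cell, IsPlacement A P ∧ P ⊆ ↑(makerMarks σ β n)

/-- The I-tetromino `P₄,₁`. -/
def P41 : Finset Cell := {(0, 0), (0, 1), (0, 2), (0, 3)}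

/-- The T-tetromino `P₄,₃`. -/
def P43 : Finset Cell := {(0, 0), (0, 1), (1, 1), (0, 2)}

/-- The S-tetromino `P₄,₅`. -/
def P45 : Finset Cell := {(0, 0), (0, 1), (1, 1), (1, 2)}


/-! ### General game lemmas -/

/-- The marked set contains a placement. -/
def PWin (A M : Finset Cell) : Prop := ∃ P : Set Cell, IsPlacement A P ∧ P ⊆ ↑M

theorem PWin.mono {A M M' : Finset Cell} (h : PWin A M) (hs : M ⊆ M') : PWin A M' := by
  obtain ⟨P, hP, hPM⟩ := h
  exact ⟨P, hP, hPM.trans (by exact_mod_cast hs)⟩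

theorem exists_fill (X R0 : Finset Cell) (b : ℕ) (hd : Disjoint R0 X) (hb : R0.card ≤ b) :
    ∃ R, R0 ⊆ R ∧ R.card = b ∧ Disjoint R X := by
  have hc : (X ∪ R0).card ≤ b + X.card := by
    have := Finset.card_union_le X R0
    omega
  obtain ⟨t, ht, htc⟩ := Infinite.exists_superset_card_eq (X ∪ R0) (b + X.card) hc
  refine ⟨t \ X, ?_, ?_, Finset.sdiff_disjoint⟩
  · intro p hp
    exact Finset.mem_sdiff.2 ⟨ht (Finset.mem_union_right _ hp), fun h => (Finset.disjoint_left.1 hd) hp h⟩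
  · rw [Finset.card_sdiff_of_subset (Finset.union_subset_left ht)]
    omega

/-- The maker, to move, can win in at most `k` turns. -/
def W (A : Finset Cell) (a b : ℕ) : ℕ → Finset Cell → Finset Cell → Prop
  | 0, M, _ => PWin A M
  | k + 1, M, B => PWin A M ∨ ∃ N : Finset Cell, N.card = a ∧ Disjoint N (M ∪ B) ∧
      ∀ R : Finset Cell, R.card = b → Disjoint R (M ∪ N ∪ B) → W A a b k (M ∪ N) (B ∪ R)

theorem W_of_PWin {A : Finset Cell} {a b k : ℕ} {M B : Finset Cell} (h : PWin A M) :
    W A a b k M B := by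
  cases k with
  | zero => exact h
  | succ k => exact Or.inl h

theorem W_move {A : Finset Cell} {a b k : ℕ} {M B : Finset Cell} (N0 : Finset Cell)
    (hM : Disjoint M B) (hc : N0.card ≤ a) (hd : Disjoint N0 B)
    (h : ∀ M' R : Finset Cell, M ∪ N0 ⊆ M' → R.card = b → Disjoint M' (B ∪ R) →
      W A a b k M' (B ∪ R)) : W A a b (k + 1) M B := by
  right
  obtain ⟨N, hN, hNc, hNd⟩ := exists_fill (M ∪ B) (N0 \ M) a (by
    rw [Finset.disjoint_union_right]
    exact ⟨Finset.sdiff_disjoint, hd.mono_left Finset.sdiff_subset⟩)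
    ((Finset.card_le_card Finset.sdiff_subset).trans hc)
  refine ⟨N, hNc, hNd, fun R hR hRd => h _ R ?_ hR ?_⟩
  · intro p hp
    by_cases hpM : p ∈ M
    · exact Finset.mem_union_left _ hpM
    · refine Finset.mem_union_right _ (hN (Finset.mem_sdiff.2 ⟨?_, hpM⟩))
      exact (Finset.mem_union.1 hp).resolve_left hpM
  · simp only [Finset.disjoint_union_right, Finset.disjoint_union_left] at *
    exact ⟨⟨hM, hNd.2⟩, hRd.1.1.symm, hRd.1.2.symm⟩

open Classical in
theorem winner_of_W {A : Finset Cell} {a b K : ℕ} (hW : W A a b K ∅ ∅) : IsWinner A a b := by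
  let good : ℕ → Finset Cell → Finset Cell → Finset Cell → Prop := fun k M B N =>
    N.card = a ∧ Disjoint N (M ∪ B) ∧ ∀ R : Finset Cell, R.card = b →
      Disjoint R (M ∪ N ∪ B) → W A a b (k - 1) (M ∪ N) (B ∪ R)
  have hgood : ∀ k M B, W A a b k M B → ∃ N, good k M B N := by
    intro k M B h
    have key : PWin A M → ∃ N, good k M B N := by
      intro h
      obtain ⟨N, -, hNc, hNd⟩ := exists_fill (M ∪ B) ∅ a (by simp) (by simp)
      exact ⟨N, hNc, hNd, fun R _ _ => W_of_PWin (h.mono Finset.subset_union_left)⟩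
    cases k with
    | zero => exact key h
    | succ k =>
      rcases h with h | ⟨N, h1, h2, h3⟩
      · exact key h
      · exact ⟨N, h1, h2, h3⟩
  let mv : ℕ → Finset Cell → Finset Cell → Finset Cell := fun k M B =>
    Classical.epsilon (good k M B)
  have hmv : ∀ k M B, W A a b k M B → good k M B (mv k M B) := fun k M B h =>
    Classical.epsilon_spec (hgood k M B h)
  let step : ℕ × Finset Cell × Finset Cell → Finset Cell → ℕ × Finset Cell × Finset Cell :=
    fun st R => (st.1 - 1, st.2.1 ∪ mv st.1 st.2.1 st.2.2, st.2.2 ∪ R)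
  let σ : List (Finset Cell) → Finset Cell := fun l =>
    let st := l.foldl step (K, ∅, ∅)
    mv st.1 st.2.1 st.2.2
  refine ⟨σ, fun β hβ => ?_⟩
  have hst : ∀ n, ((List.range n).map β).foldl step (K, ∅, ∅) =
      (K - n, makerMarks σ β n, breakerMarks β n) := by
    intro n
    induction n with
    | zero => rfl
    | succ n ih =>
      rw [List.range_succ, List.map_append, List.foldl_append, ih]
      have : makerMove σ β n = mv (K - n) (makerMarks σ β n) (breakerMarks β n) := by
        simp only [makerMove, σ, ih]
      simp only [List.map_cons, List.map_nil, List.foldl_cons, List.foldl_nil, step, makerMarks,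
        breakerMarks, this, Nat.sub_sub]
  have hmm : ∀ n, makerMove σ β n = mv (K - n) (makerMarks σ β n) (breakerMarks β n) := by
    intro n
    simp only [makerMove, σ, hst n]
  have hWn : ∀ n, W A a b (K - n) (makerMarks σ β n) (breakerMarks β n) := by
    intro n
    induction n with
    | zero => exact hW
    | succ n ih =>
      have h := (hmv _ _ _ ih).2.2 (β n) (hβ n).1 (by
        have := (hβ n).2
        rw [← hmm, Finset.union_assoc, Finset.union_comm]
        rw [makerMarks, Finset.union_comm] at this
        rw [Finset.union_assoc]
        refine this.mono_right ?_
        intro p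
        simp only [Finset.mem_union]
        tauto)
      rw [← hmm, Nat.sub_sub] at h
      exact h
  refine ⟨fun n => ?_, K, ?_⟩
  · have h := hmv _ _ _ (hWn n)
    rw [← hmm] at h
    exact ⟨h.1, h.2.1⟩
  · have h := hWn K
    rw [Nat.sub_self] at h
    exact h

open Classical in
theorem loser_of_inv {A : Finset Cell} {a b : ℕ} (Inv : Finset Cell → Finset Cell → Prop)
    (h0 : Inv ∅ ∅)
    (hwin : ∀ M B N : Finset Cell, Inv M B → N.card = a → Disjoint N (M ∪ B) → ¬ PWin A (M ∪ N))
    (hstep : ∀ M B N : Finset Cell, Inv M B → N.card = a → Disjoint N (M ∪ B) →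
      ∃ R : Finset Cell, R.card = b ∧ Disjoint R (M ∪ N ∪ B) ∧ Inv (M ∪ N) (B ∪ R)) :
    ¬ IsWinner A a b := by
  rintro ⟨σ, hσ⟩
  let good : Finset Cell → Finset Cell → Finset Cell → Finset Cell → Prop := fun M N B R =>
    R.card = b ∧ Disjoint R (M ∪ N ∪ B) ∧
      (Inv M B → N.card = a → Disjoint N (M ∪ B) → Inv (M ∪ N) (B ∪ R))
  have hgood : ∀ M N B, ∃ R, good M N B R := by
    intro M N B
    by_cases h : Inv M B ∧ N.card = a ∧ Disjoint N (M ∪ B)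
    · obtain ⟨R, h1, h2, h3⟩ := hstep M B N h.1 h.2.1 h.2.2
      exact ⟨R, h1, h2, fun _ _ _ => h3⟩
    · obtain ⟨R, -, h1, h2⟩ := exists_fill (M ∪ N ∪ B) ∅ b (by simp) (by simp)
      exact ⟨R, h1, h2, fun x y z => (h ⟨x, y, z⟩).elim⟩
  choose f hf using hgood
  let st : ℕ → List (Finset Cell) × Finset Cell × Finset Cell := fun n =>
    Nat.rec ([], ∅, ∅) (fun _ s =>
      (s.1 ++ [f s.2.1 (σ s.1) s.2.2], s.2.1 ∪ σ s.1, s.2.2 ∪ f s.2.1 (σ s.1) s.2.2)) n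
  let β : ℕ → Finset Cell := fun n => f (st n).2.1 (σ (st n).1) (st n).2.2
  have hl : ∀ n, (List.range n).map β = (st n).1 := by
    intro n
    induction n with
    | zero => rfl
    | succ n ih =>
      rw [List.range_succ, List.map_append, ih]
      rfl
  have hM : ∀ n, makerMarks σ β n = (st n).2.1 := by
    intro n
    induction n with
    | zero => rfl
    | succ n ih =>
      rw [makerMarks, ih, makerMove, hl]
  have hB : ∀ n, breakerMarks β n = (st n).2.2 := by
    intro n
    induction n with
    | zero => rfl
    | succ n ih => rw [breakerMarks, ih]
  have hleg : BreakerLegal b σ β := by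
    intro n
    have h := hf (st n).2.1 (σ (st n).1) (st n).2.2
    refine ⟨h.1, ?_⟩
    rw [makerMarks, hM, hB, makerMove, hl]
    exact h.2.1
  obtain ⟨hml, n, hn⟩ := hσ β hleg
  have hmm : ∀ n, (σ (st n).1).card = a ∧ Disjoint (σ (st n).1) ((st n).2.1 ∪ (st n).2.2) := by
    intro n
    have := hml n
    rwa [makerMove, hl, hM, hB] at this
  have hinv : ∀ n, Inv (st n).2.1 (st n).2.2 := by
    intro n
    induction n with
    | zero => exact h0
    | succ n ih =>
      exact (hf (st n).2.1 (σ (st n).1) (st n).2.2).2.2 ih (hmm n).1 (hmm n).2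
  refine hwin _ _ _ (hinv n) (hmm n).1 (hmm n).2 ?_
  have hn' : PWin A (makerMarks σ β n) := hn
  rw [hM] at hn'
  exact hn'.mono Finset.subset_union_left

theorem winner_four {A : Finset Cell} (hA : A.card = 4) (n b : ℕ) (hn : 4 ≤ n) :
    IsWinner A n b := by
  refine winner_of_W (K := 1) (W_move A (by simp) (by omega) (by simp) ?_)
  intro M' R hM' _ _
  refine W_of_PWin (PWin.mono ?_ (Finset.union_subset_right hM'))
  refine ⟨_, ⟨id, ⟨1, 1, false, (0, 0), Or.inl rfl, Or.inl rfl, by simp⟩, rfl⟩, by simp⟩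

/-! ### The `(3,11)` and `(2,3)` games -/

/-- Translate a finite set of cells. -/
def tr (c : Cell) (S : Finset Cell) : Finset Cell := S.image (fun p => (p.1 + c.1, p.2 + c.2))

/-- Breaker cells in the vertical strip around `c`. -/
def nearB (B : Finset Cell) (c : Cell) : Finset Cell := B.filter (fun p => |p.1 - c.1| < 10)

/-- `S` is the image of `A` under a symmetry, in explicit form. -/
def Pl (A S : Finset Cell) : Prop := ∃ (e₁ e₂ : ℤ) (s : Bool) (t : Cell),
    (e₁ = 1 ∨ e₁ = -1) ∧ (e₂ = 1 ∨ e₂ = -1) ∧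
    S = A.image (fun p => if s then (e₁ * p.2 + t.1, e₂ * p.1 + t.2)
      else (e₁ * p.1 + t.1, e₂ * p.2 + t.2))

theorem Pl.pwin {A S : Finset Cell} (h : Pl A S) (c : Cell) : PWin A (tr c S) := by
  obtain ⟨e₁, e₂, s, t, h1, h2, rfl⟩ := h
  refine ⟨_, ⟨fun p => if s then (e₁ * p.2 + (t.1 + c.1), e₂ * p.1 + (t.2 + c.2))
      else (e₁ * p.1 + (t.1 + c.1), e₂ * p.2 + (t.2 + c.2)),
      ⟨e₁, e₂, s, (t.1 + c.1, t.2 + c.2), h1, h2, fun p => rfl⟩, rfl⟩, ?_⟩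
  rintro _ ⟨p, hp, rfl⟩
  simp only [tr, Finset.coe_image, Set.mem_image, Finset.mem_coe, exists_exists_and_eq_and]
  refine ⟨p, hp, ?_⟩
  cases s <;> simp [add_assoc]

/-- Pairwise far cells. -/
def FarSet (C : Finset Cell) : Prop := ∀ x ∈ C, ∀ y ∈ C, x ≠ y → 20 ≤ |x.1 - y.1|

theorem exists_far (X : Finset Cell) : ∃ c : Cell, ∀ x ∈ X, 20 ≤ |x.1 - c.1| := by
  obtain ⟨m, hm⟩ := (X.image Prod.fst).bddAbove
  refine ⟨(m + 20, 0), fun x hx => ?_⟩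
  have : x.1 ≤ m := hm (by simpa using ⟨x.2, hx⟩)
  rw [le_abs]
  right
  simp only
  omega

theorem exists_far_extend (C B : Finset Cell) (hC : FarSet C) (k : ℕ) :
    ∃ N : Finset Cell, N.card = k ∧ Disjoint N (C ∪ B) ∧ FarSet (C ∪ N) := by
  induction k with
  | zero => exact ⟨∅, by simp, by simp, by simpa using hC⟩
  | succ k ih =>
    obtain ⟨N, h1, h2, h3⟩ := ih
    obtain ⟨c, hc⟩ := exists_far (C ∪ B ∪ N)
    have hc' : c ∉ C ∪ B ∪ N := by
      intro h
      have := hc c h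
      simp at this
    simp only [Finset.mem_union, not_or] at hc'
    refine ⟨insert c N, by rw [Finset.card_insert_of_notMem hc'.2, h1], ?_, ?_⟩
    · rw [Finset.disjoint_insert_left]
      exact ⟨by simp [hc'.1], h2⟩
    · intro x hx y hy hxy
      have key : ∀ z, z ∈ C ∪ insert c N → z = c ∨ z ∈ C ∪ N := by
        intro z hz
        simp only [Finset.mem_union, Finset.mem_insert] at hz ⊢
        tauto
      have key2 : ∀ z ∈ C ∪ N, 20 ≤ |z.1 - c.1| := by
        intro z hz
        apply hc
        simp only [Finset.mem_union] at hz ⊢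
        tauto
      rcases key x hx with rfl | hx' <;> rcases key y hy with rfl | hy'
      · exact absurd rfl hxy
      · rw [abs_sub_comm]
        exact key2 y hy'
      · exact key2 x hx'
      · exact h3 x hx' y hy' hxy

theorem sum_near_le (C B : Finset Cell) (hC : FarSet C) :
    ∑ c ∈ C, (nearB B c).card ≤ B.card := by
  rw [← Finset.card_biUnion]
  · exact Finset.card_le_card (Finset.biUnion_subset.2 fun c _ => Finset.filter_subset _ _)
  · intro x hx y hy hxy
    rw [Function.onFun, Finset.disjoint_left]
    intro p hp hq
    simp only [nearB, Finset.mem_filter, abs_lt] at hp hq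
    have := hC x hx y hy hxy
    rw [le_abs] at this
    omega

/-- A family of more than `|B ∩ strip|` disjoint sets contains one which avoids `B`. -/
theorem exists_avoid (B : Finset Cell) (c : Cell) (L : Finset (Finset Cell))
    (hdis : ∀ S ∈ L, ∀ T ∈ L, S ≠ T → Disjoint S T)
    (hnear : ∀ S ∈ L, ∀ p ∈ S, |p.1| < 10) (hcard : (nearB B c).card < L.card) :
    ∃ S ∈ L, Disjoint (tr c S) B := by
  by_contra hcon
  push Not at hcon
  have : ∀ S ∈ L, ∃ p ∈ S, (p.1 + c.1, p.2 + c.2) ∈ B := by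
    intro S hS
    have := hcon S hS
    rw [Finset.not_disjoint_iff] at this
    obtain ⟨q, hq, hqB⟩ := this
    simp only [tr, Finset.mem_image] at hq
    obtain ⟨p, hp, rfl⟩ := hq
    exact ⟨p, hp, hqB⟩
  choose! f hf hfB using this
  refine absurd (Finset.card_le_card_of_injOn (s := L) (t := nearB B c)
    (fun S => ((f S).1 + c.1, (f S).2 + c.2)) ?_ ?_) (by omega)
  · intro S hS
    simp only [nearB, Finset.coe_filter, Set.mem_ofPred_eq]
    exact ⟨hfB S hS, by simpa using hnear S hS _ (hf S hS)⟩
  · intro S hS T hT hST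
    by_contra hne
    simp only [Prod.mk.injEq, add_left_inj] at hST
    have : f S = f T := Prod.ext hST.1 hST.2
    exact (Finset.disjoint_left.1 (hdis S hS T hT hne)) (hf S hS) (this ▸ hf T hT)

theorem tr_subset {c : Cell} {S M : Finset Cell} (h : ∀ p ∈ S, (p.1 + c.1, p.2 + c.2) ∈ M) :
    tr c S ⊆ M := by
  intro q hq
  simp only [tr, Finset.mem_image] at hq
  obtain ⟨p, hp, rfl⟩ := hq
  exact h p hp

theorem tr_card (c : Cell) (S : Finset Cell) : (tr c S).card ≤ S.card := Finset.card_image_le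

theorem tr_insert_subset {c y : Cell} {S M : Finset Cell} (h1 : (y.1 + c.1, y.2 + c.2) ∈ M)
    (h2 : tr c S ⊆ M) : tr c (insert y S) ⊆ M := by
  rw [tr, Finset.image_insert]
  exact Finset.insert_subset h1 h2

theorem winner_3_11 {A : Finset Cell} (L : Finset (Finset Cell)) (hL : L.card = 4)
    (hdis : ∀ S ∈ L, ∀ T ∈ L, S ≠ T → Disjoint S T)
    (hnear : ∀ S ∈ L, ∀ p ∈ S, |p.1| < 10) (hcard : ∀ S ∈ L, S.card = 3)
    (hpl : ∀ S ∈ L, Pl A (insert (0, 0) S)) : IsWinner A 3 11 := by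
  obtain ⟨N, hN, -, hfar⟩ := exists_far_extend ∅ ∅ (by simp [FarSet]) 3
  rw [Finset.empty_union] at hfar
  refine winner_of_W (K := 2) (W_move N (by simp) hN.le (by simp) ?_)
  intro M R hM hR hd
  rw [Finset.empty_union] at *
  have hsum := sum_near_le N R hfar
  have : ∃ c ∈ N, (nearB R c).card < 4 := by
    by_contra h
    push Not at h
    have := Finset.card_nsmul_le_sum N _ 4 h
    rw [hN, smul_eq_mul] at this
    omega
  obtain ⟨c, hcN, hc⟩ := this
  obtain ⟨S, hS, hSd⟩ := exists_avoid R c L hdis hnear (by omega)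
  refine W_move (tr c S) hd ((tr_card c S).trans (hcard S hS).le) hSd ?_
  intro M' _ hM' _ _
  refine W_of_PWin (((hpl S hS).pwin c).mono (tr_insert_subset ?_ ?_))
  · simpa using hM' (Finset.mem_union_left _ (hM hcN))
  · exact (Finset.subset_union_right).trans hM'

theorem two_good (C B : Finset Cell) (hC : FarSet C) (h6 : C.card = 6) (h9 : B.card ≤ 9) :
    ∃ c ∈ C, ∃ d ∈ C, c ≠ d ∧ (nearB B c).card ≤ 1 ∧ (nearB B d).card ≤ 1 := by
  have hsum := sum_near_le C B hC
  by_contra hcon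
  have hG : (C.filter (fun c => (nearB B c).card ≤ 1)).card ≤ 1 := by
    rw [Finset.card_le_one]
    intro c hc d hd
    rw [Finset.mem_filter] at hc hd
    by_contra hne
    exact hcon ⟨c, hc.1, d, hd.1, hne, hc.2, hd.2⟩
  have h1 := Finset.card_filter_add_card_filter_not (s := C) (fun c => (nearB B c).card ≤ 1)
  have h2 := Finset.card_nsmul_le_sum (C.filter (fun c => ¬ (nearB B c).card ≤ 1))
    (fun c => (nearB B c).card) 2 (by
      intro c hc
      rw [Finset.mem_filter] at hc
      omega)
  have h3 : ∑ c ∈ C.filter (fun c => ¬ (nearB B c).card ≤ 1), (nearB B c).card ≤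
      ∑ c ∈ C, (nearB B c).card :=
    Finset.sum_le_sum_of_subset (Finset.filter_subset _ _)
  rw [smul_eq_mul] at h2
  omega

/-- An option for the `(2,3)` game: after marking `y` next to the origin, two disjoint pairs
complete a placement. -/
structure Opt (A : Finset Cell) where
  y : Cell
  Q1 : Finset Cell
  Q2 : Finset Cell
  hne : Q1 ≠ Q2
  hdis : Disjoint Q1 Q2
  c1 : Q1.card = 2
  c2 : Q2.card = 2
  n1 : ∀ p ∈ Q1, |p.1| < 10
  n2 : ∀ p ∈ Q2, |p.1| < 10
  ny : |y.1| < 10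
  p1 : Pl A (insert (0, 0) (insert y Q1))
  p2 : Pl A (insert (0, 0) (insert y Q2))

/-- All cells used by an option. -/
def Opt.all {A : Finset Cell} (o : Opt A) : Finset Cell := insert o.y (o.Q1 ∪ o.Q2)

theorem Opt.finish {A : Finset Cell} (o : Opt A) {M B R : Finset Cell} {c : Cell} {k : ℕ}
    (hc : c ∈ M) (hy : (o.y.1 + c.1, o.y.2 + c.2) ∈ M) (hd : Disjoint M (B ∪ R))
    (hB : Disjoint (tr c o.all) B) (hR : (nearB R c).card ≤ 1) :
    W A 2 3 (k + 1) M (B ∪ R) := by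
  obtain ⟨S, hS, hSd⟩ := exists_avoid R c {o.Q1, o.Q2}
    (by
      intro S hS T hT hST
      simp only [Finset.mem_insert, Finset.mem_singleton] at hS hT
      rcases hS with rfl | rfl <;> rcases hT with rfl | rfl
      · exact absurd rfl hST
      · exact o.hdis
      · exact o.hdis.symm
      · exact absurd rfl hST)
    (by
      intro S hS
      simp only [Finset.mem_insert, Finset.mem_singleton] at hS
      rcases hS with rfl | rfl
      · exact o.n1
      · exact o.n2)
    (by rw [Finset.card_pair o.hne]; omega)
  simp only [Finset.mem_insert, Finset.mem_singleton] at hS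
  have hall : S ⊆ o.all ∧ S.card = 2 ∧ Pl A (insert (0, 0) (insert o.y S)) := by
    rcases hS with rfl | rfl
    · exact ⟨fun p hp => by simp [Opt.all, hp], o.c1, o.p1⟩
    · exact ⟨fun p hp => by simp [Opt.all, hp], o.c2, o.p2⟩
  refine W_move (tr c S) hd ((tr_card c S).trans hall.2.1.le) ?_ ?_
  · rw [Finset.disjoint_union_right]
    exact ⟨hB.mono_left (Finset.image_subset_image hall.1), hSd⟩
  · intro M' _ hM' _ _
    have hMM : M ⊆ M' := Finset.subset_union_left.trans hM'
    refine W_of_PWin ((hall.2.2.pwin c).mono (tr_insert_subset ?_ (tr_insert_subset ?_ ?_)))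
    · simpa using hMM hc
    · exact hMM hy
    · exact Finset.subset_union_right.trans hM'

theorem Opt.choice {A : Finset Cell} (o o' : Opt A) (hoo : Disjoint o.all o'.all)
    {B : Finset Cell} {c : Cell} (h : (nearB B c).card ≤ 1) :
    ∃ u : Opt A, Disjoint (tr c u.all) B := by
  have hall : ∀ u : Opt A, ∀ p ∈ u.all, |p.1| < 10 := by
    intro u p hp
    simp only [Opt.all, Finset.mem_insert, Finset.mem_union] at hp
    rcases hp with rfl | hp | hp
    · exact u.ny
    · exact u.n1 p hp
    · exact u.n2 p hp
  have hne : o.all ≠ o'.all := by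
    intro h
    rw [← h, disjoint_self, Finset.bot_eq_empty] at hoo
    have : o.y ∈ o.all := by simp [Opt.all]
    rw [hoo] at this
    simp at this
  obtain ⟨S, hS, hSd⟩ := exists_avoid B c {o.all, o'.all}
    (by
      intro S hS T hT hST
      simp only [Finset.mem_insert, Finset.mem_singleton] at hS hT
      rcases hS with rfl | rfl <;> rcases hT with rfl | rfl
      · exact absurd rfl hST
      · exact hoo
      · exact hoo.symm
      · exact absurd rfl hST)
    (by
      intro S hS
      simp only [Finset.mem_insert, Finset.mem_singleton] at hS
      rcases hS with rfl | rfl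
      · exact hall o
      · exact hall o')
    (by rw [Finset.card_pair hne]; omega)
  simp only [Finset.mem_insert, Finset.mem_singleton] at hS
  rcases hS with rfl | rfl
  · exact ⟨o, hSd⟩
  · exact ⟨o', hSd⟩

theorem winner_2_3 {A : Finset Cell} (o o' : Opt A) (hoo : Disjoint o.all o'.all) :
    IsWinner A 2 3 := by
  have phase2 : ∀ M B C : Finset Cell, C ⊆ M → FarSet C → C.card = 6 → B.card ≤ 9 →
      Disjoint M B → W A 2 3 2 M B := by
    intro M B C hCM hfar h6 h9 hd
    obtain ⟨c, hc, d, hdC, hcd, hnc, hnd⟩ := two_good C B hfar h6 h9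
    obtain ⟨u, hu⟩ := o.choice o' hoo hnc
    obtain ⟨v, hv⟩ := o.choice o' hoo hnd
    have hy : ∀ (w : Opt A) (e : Cell), Disjoint (tr e w.all) B →
        (w.y.1 + e.1, w.y.2 + e.2) ∉ B := by
      intro w e hw
      refine Finset.disjoint_left.1 hw ?_
      rw [tr, Finset.mem_image]
      exact ⟨w.y, by simp [Opt.all], rfl⟩
    refine W_move {(u.y.1 + c.1, u.y.2 + c.2), (v.y.1 + d.1, v.y.2 + d.2)} hd
      Finset.card_le_two ?_ ?_
    · simp only [Finset.disjoint_insert_left, Finset.disjoint_singleton_left]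
      exact ⟨hy u c hu, hy v d hv⟩
    · intro M' R hM' hR hd'
      have hsum := sum_near_le {c, d} R (by
        intro x hx y hy hxy
        simp only [Finset.mem_insert, Finset.mem_singleton] at hx hy
        refine hfar x ?_ y ?_ hxy
        · rcases hx with rfl | rfl <;> assumption
        · rcases hy with rfl | rfl <;> assumption)
      rw [Finset.sum_pair hcd] at hsum
      have hMM : M ⊆ M' := Finset.subset_union_left.trans hM'
      by_cases h1 : (nearB R c).card ≤ 1
      · exact u.finish (hMM (hCM hc)) (hM' (by simp)) hd' hu h1
      · exact v.finish (hMM (hCM hdC)) (hM' (by simp)) hd' hv (by omega)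
  have phase1 : ∀ k : ℕ, k ≤ 3 → ∀ M B C : Finset Cell, C ⊆ M → FarSet C →
      C.card = 2 * (3 - k) → B.card ≤ 3 * (3 - k) → Disjoint M B → W A 2 3 (2 + k) M B := by
    intro k
    induction k with
    | zero => intro _ M B C h1 h2 h3 h4 h5; exact phase2 M B C h1 h2 h3 h4 h5
    | succ k ih =>
      intro hk M B C h1 h2 h3 h4 h5
      obtain ⟨N, hN, hNd, hNf⟩ := exists_far_extend C B h2 2
      rw [Finset.disjoint_union_right] at hNd
      refine W_move N h5 hN.le hNd.2 ?_
      intro M' R hM' hR hd'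
      refine ih (by omega) M' (B ∪ R) (C ∪ N) ?_ hNf ?_ ?_ hd'
      · exact (Finset.union_subset_union_left h1).trans hM'
      · rw [Finset.card_union_of_disjoint hNd.1.symm]; omega
      · have := Finset.card_union_le B R; omega
  exact winner_of_W (K := 5) (phase1 3 le_rfl ∅ ∅ ∅ (by simp) (by simp [FarSet]) (by simp)
    (by simp) (by simp))

/-- Concrete options. -/
def optI : Opt P41 := ⟨(0, 1), {(0, -1), (0, -2)}, {(0, 2), (0, 3)}, by decide, by decide,
  by decide, by decide, by decide, by decide, by decide,
  ⟨1, 1, false, (0, -2), by decide, by decide, by decide⟩,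
  ⟨1, 1, false, (0, 0), by decide, by decide, by decide⟩⟩

def optI' : Opt P41 := ⟨(1, 0), {(-1, 0), (-2, 0)}, {(2, 0), (3, 0)}, by decide, by decide,
  by decide, by decide, by decide, by decide, by decide,
  ⟨1, 1, true, (-2, 0), by decide, by decide, by decide⟩,
  ⟨1, 1, true, (0, 0), by decide, by decide, by decide⟩⟩

def optT : Opt P43 := ⟨(1, 1), {(1, 0), (2, 0)}, {(0, 1), (0, 2)}, by decide, by decide,
  by decide, by decide, by decide, by decide, by decide,
  ⟨1, 1, true, (0, 0), by decide, by decide, by decide⟩,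
  ⟨1, 1, false, (0, 0), by decide, by decide, by decide⟩⟩

def optT' : Opt P43 := ⟨(-1, -1), {(-1, 0), (-2, 0)}, {(0, -1), (0, -2)}, by decide, by decide,
  by decide, by decide, by decide, by decide, by decide,
  ⟨-1, -1, true, (0, 0), by decide, by decide, by decide⟩,
  ⟨-1, -1, false, (0, 0), by decide, by decide, by decide⟩⟩

def optS : Opt P45 := ⟨(1, 1), {(1, 0), (2, 1)}, {(0, 1), (1, 2)}, by decide, by decide,
  by decide, by decide, by decide, by decide, by decide,
  ⟨1, 1, true, (0, 0), by decide, by decide, by decide⟩,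
  ⟨1, 1, false, (0, 0), by decide, by decide, by decide⟩⟩

def optS' : Opt P45 := ⟨(-1, -1), {(-1, 0), (-2, -1)}, {(0, -1), (-1, -2)}, by decide, by decide,
  by decide, by decide, by decide, by decide, by decide,
  ⟨-1, -1, true, (0, 0), by decide, by decide, by decide⟩,
  ⟨-1, -1, false, (0, 0), by decide, by decide, by decide⟩⟩

theorem w23I : IsWinner P41 2 3 := winner_2_3 optI optI' (by decide)
theorem w23T : IsWinner P43 2 3 := winner_2_3 optT optT' (by decide)
theorem w23S : IsWinner P45 2 3 := winner_2_3 optS optS' (by decide)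

theorem w311I : IsWinner P41 3 11 := by
  refine winner_3_11 {{(1, 0), (2, 0), (3, 0)}, {(-1, 0), (-2, 0), (-3, 0)},
    {(0, 1), (0, 2), (0, 3)}, {(0, -1), (0, -2), (0, -3)}} (by decide) (by decide) (by decide)
    (by decide) ?_
  intro S hS
  simp only [Finset.mem_insert, Finset.mem_singleton] at hS
  rcases hS with rfl | rfl | rfl | rfl
  · exact ⟨1, 1, true, (0, 0), by decide, by decide, by decide⟩
  · exact ⟨-1, 1, true, (0, 0), by decide, by decide, by decide⟩
  · exact ⟨1, 1, false, (0, 0), by decide, by decide, by decide⟩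
  · exact ⟨1, -1, false, (0, 0), by decide, by decide, by decide⟩

theorem w311T : IsWinner P43 3 11 := by
  refine winner_3_11 {{(1, 0), (2, 0), (1, 1)}, {(-1, 0), (-2, 0), (-1, -1)},
    {(0, 1), (0, 2), (-1, 1)}, {(0, -1), (0, -2), (1, -1)}} (by decide) (by decide) (by decide)
    (by decide) ?_
  intro S hS
  simp only [Finset.mem_insert, Finset.mem_singleton] at hS
  rcases hS with rfl | rfl | rfl | rfl
  · exact ⟨1, 1, true, (0, 0), by decide, by decide, by decide⟩
  · exact ⟨-1, -1, true, (0, 0), by decide, by decide, by decide⟩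
  · exact ⟨-1, 1, false, (0, 0), by decide, by decide, by decide⟩
  · exact ⟨1, -1, false, (0, 0), by decide, by decide, by decide⟩

theorem w311S : IsWinner P45 3 11 := by
  refine winner_3_11 {{(1, 0), (1, 1), (2, 1)}, {(-1, 0), (-1, -1), (-2, -1)},
    {(0, 1), (-1, 1), (-1, 2)}, {(0, -1), (1, -1), (1, -2)}} (by decide) (by decide) (by decide)
    (by decide) ?_
  intro S hS
  simp only [Finset.mem_insert, Finset.mem_singleton] at hS
  rcases hS with rfl | rfl | rfl | rfl
  · exact ⟨1, 1, true, (0, 0), by decide, by decide, by decide⟩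
  · exact ⟨-1, -1, true, (0, 0), by decide, by decide, by decide⟩
  · exact ⟨-1, 1, false, (0, 0), by decide, by decide, by decide⟩
  · exact ⟨1, -1, false, (0, 0), by decide, by decide, by decide⟩

/-! ### The `(1,1)` game -/

/-- Strategy certificates, as forests in first-child / next-sibling form. -/
inductive Fo
  | e : Fo
  | z (g : ℕ) : Fo
  | c (x : ℕ) (kids rest : Fo) : Fo

/-- The cell with a given number. -/
def cel (i : ℕ) : Cell := ((i / 8 : ℕ), (i % 8 : ℕ))

theorem cel_inj {i j : ℕ} (h : cel i = cel j) : i = j := by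
  simp only [cel, Prod.mk.injEq, Nat.cast_inj] at h
  omega

/-- The supports of all strategies in a forest (bit masks). -/
def sups : Fo → List ℕ
  | .e => []
  | .z _ => []
  | .c x k r => (sups k).foldr (· ||| ·) (1 <<< x) :: sups r

/-- Bitwise intersection of a nonempty list. -/
def interL : ℕ → List ℕ → ℕ
  | s, [] => s
  | s, t :: l => s &&& interL t l

/-- Whether the intersection of a list of masks is empty. -/
def emptyInter : List ℕ → Bool
  | [] => false
  | s :: l => interL s l == 0

/-- The symmetry with a given number. -/
def symF (g : ℕ) (p : Cell) : Cell :=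
  let e₁ : ℤ := if g.testBit 0 then -1 else 1
  let e₂ : ℤ := if g.testBit 1 then -1 else 1
  let t := cel (g / 8)
  if g.testBit 2 then (e₁ * p.2 + t.1, e₂ * p.1 + t.2) else (e₁ * p.1 + t.1, e₂ * p.2 + t.2)

/-- The marked mask contains the image of `A` under symmetry number `g`. -/
def winsB (A : List Cell) (m g : ℕ) : Bool :=
  A.all fun p => let q := symF g p
    decide (0 ≤ q.1) && decide (0 ≤ q.2) && decide (q.2 < 8) &&
      m.testBit (8 * q.1.toNat + q.2.toNat)

/-- A winning leaf. -/
def leafOK (A : List Cell) (m : ℕ) : Fo → Bool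
  | .z g => winsB A m g
  | _ => false

/-- Certificate checker. -/
def valid (A : List Cell) : Fo → ℕ → ℕ → Bool
  | .e, _, _ => true
  | .z _, _, _ => true
  | .c x k r, d, m =>
    (match d with
      | 0 => false
      | d + 1 => leafOK A (m ||| 1 <<< x) k ||
        (emptyInter (sups k) && valid A k d (m ||| 1 <<< x))) && valid A r d m

theorem winsB_sound {A : Finset Cell} {L : List Cell} (hA : ∀ p ∈ A, p ∈ L) {m g : ℕ}
    {M : Finset Cell} (hm : ∀ i, m.testBit i = true → cel i ∈ M) (h : winsB L m g = true) :
    PWin A M := by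
  refine ⟨_, ⟨symF g, ⟨if g.testBit 0 then -1 else 1, if g.testBit 1 then -1 else 1,
    g.testBit 2, cel (g / 8), ?_, ?_, fun p => rfl⟩, rfl⟩, ?_⟩
  · split <;> simp
  · split <;> simp
  · rintro _ ⟨p, hp, rfl⟩
    have := List.all_eq_true.1 h p (hA p (by simpa using hp))
    simp only [Bool.and_eq_true, decide_eq_true_eq] at this
    obtain ⟨⟨⟨h1, h2⟩, h3⟩, h4⟩ := this
    have h5 := hm _ h4
    have : cel (8 * (symF g p).1.toNat + (symF g p).2.toNat) = symF g p := by
      apply Prod.ext <;> simp only [cel] <;> omega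
    rw [this] at h5
    exact_mod_cast h5

theorem interL_spec {i : ℕ} : ∀ (l : List ℕ) (s : ℕ), (interL s l).testBit i = false →
    ∃ u ∈ s :: l, u.testBit i = false
  | [], s, h => ⟨s, by simp, h⟩
  | t :: l, s, h => by
    rw [interL, Nat.testBit_land, Bool.and_eq_false_iff] at h
    rcases h with h | h
    · exact ⟨s, by simp, h⟩
    · obtain ⟨u, hu, hu'⟩ := interL_spec l t h
      exact ⟨u, List.mem_cons_of_mem _ hu, hu'⟩

theorem emptyInter_spec {l : List ℕ} (h : emptyInter l = true) (i : ℕ) :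
    ∃ u ∈ l, u.testBit i = false := by
  cases l with
  | nil => simp [emptyInter] at h
  | cons s l =>
    simp only [emptyInter, beq_iff_eq] at h
    exact interL_spec l s (by simp [h])

theorem foldr_or_testBit (l : List ℕ) (a i : ℕ) :
    (l.foldr (· ||| ·) a).testBit i = true ↔ a.testBit i = true ∨ ∃ u ∈ l, u.testBit i = true := by
  induction l with
  | nil => simp
  | cons s l ih =>
    rw [List.foldr_cons, Nat.testBit_lor, Bool.or_eq_true, ih]
    simp only [List.mem_cons, exists_eq_or_imp]
    tauto

theorem shift_testBit (x i : ℕ) : (1 <<< x).testBit i = true ↔ i = x := by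
  rw [Nat.one_shiftLeft, Nat.testBit_two_pow]
  simp [eq_comm]

theorem valid_sound {A : Finset Cell} {L : List Cell} (hA : ∀ p ∈ A, p ∈ L) :
    ∀ (F : Fo) (d m : ℕ) (M B : Finset Cell), valid L F d m = true →
      (∀ i, m.testBit i = true → cel i ∈ M) → Disjoint M B → ∀ s ∈ sups F,
      (∀ i, s.testBit i = true → cel i ∉ B) → W A 1 1 d M B := by
  intro F
  induction F with
  | e => intro d m M B _ _ _ s hs; simp [sups] at hs
  | z g => intro d m M B _ _ _ s hs; simp [sups] at hs
  | c x k r ihk ihr =>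
    intro d m M B hv hm hd s hs hsB
    unfold valid at hv
    rw [Bool.and_eq_true] at hv
    rw [sups, List.mem_cons] at hs
    rcases hs with rfl | hs
    swap
    · exact ihr d m M B hv.2 hm hd s hs hsB
    · cases d with
      | zero => simp at hv
      | succ d =>
        have hv := hv.1
        have hx : cel x ∉ B := hsB x ((foldr_or_testBit _ _ _).2 (Or.inl ((shift_testBit x x).2 rfl)))
        refine W_move {cel x} hd (by simp) (by simpa using hx) ?_
        intro M' R hM' hR hd'
        have hm' : ∀ i, (m ||| 1 <<< x).testBit i = true → cel i ∈ M' := by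
          intro i hi
          rw [Nat.testBit_lor, Bool.or_eq_true, shift_testBit] at hi
          rcases hi with hi | rfl
          · exact hM' (Finset.mem_union_left _ (hm i hi))
          · exact hM' (by simp)
        have main : emptyInter (sups k) = true → valid L k d (m ||| 1 <<< x) = true →
            W A 1 1 d M' (B ∪ R) := by
          intro h1 h2
          obtain ⟨r0, rfl⟩ := Finset.card_eq_one.1 hR
          have : ∃ u ∈ sups k, ∀ i, u.testBit i = true → cel i ≠ r0 := by
            by_cases hr : ∃ i, cel i = r0
            · obtain ⟨i, rfl⟩ := hr
              obtain ⟨u, hu, hui⟩ := emptyInter_spec h1 i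
              refine ⟨u, hu, fun j hj hji => ?_⟩
              rw [cel_inj hji, hui] at hj
              cases hj
            · obtain ⟨u, hu, -⟩ := emptyInter_spec h1 0
              exact ⟨u, hu, fun i _ h => hr ⟨i, h⟩⟩
          obtain ⟨u, hu, hur⟩ := this
          refine ihk d _ M' _ h2 hm' hd' u hu fun i hi => ?_
          rw [Finset.mem_union, not_or, Finset.mem_singleton]
          exact ⟨hsB i ((foldr_or_testBit _ _ _).2 (Or.inr ⟨u, hu, hi⟩)), hur i hi⟩
        rw [Bool.or_eq_true, Bool.and_eq_true] at hv
        rcases hv with hv | hv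
        · cases k with
          | z g => exact W_of_PWin (winsB_sound hA hm' hv)
          | e => cases hv
          | c x' k' r' => cases hv
        · exact main hv.1 hv.2

theorem winner_1_1 {A : Finset Cell} (L : List Cell) (hA : ∀ p ∈ A, p ∈ L) (F : Fo) (d : ℕ)
    (h : (valid L F d 0 && !(sups F).isEmpty) = true) : IsWinner A 1 1 := by
  rw [Bool.and_eq_true] at h
  have : ∃ s, s ∈ sups F := by
    have := h.2
    cases hF : sups F with
    | nil => simp [hF] at this
    | cons s l => exact ⟨s, by simp⟩
  obtain ⟨s, hs⟩ := this
  exact winner_of_W (valid_sound hA F d 0 ∅ ∅ h.1 (by simp) (by simp) s hs (by simp))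

/-- Winning strategy certificate for I. -/
def treeI : Fo :=
  (.c 27 (.c 19 (.c 35 (.c 11 (.z 92) (.c 43 (.z 156) .e)) (.c 28 (.c 26 (.c 25 (.z 200) (.c 29
  (.z 208) .e)) (.c 20 (.c 36 (.c 12 (.z 100) (.c 44 (.z 164) .e)) (.c 18 (.c 17 (.z 136) (.c 21
  (.z 144) .e)) .e)) .e)) .e)) (.c 28 (.c 26 (.c 25 (.z 200) (.c 29 (.z 208) .e)) (.c 37 (.c 29
  (.c 30 (.z 216) (.c 21 (.c 13 (.z 108) (.c 45 (.z 172) .e)) .e)) (.c 36 (.c 35 (.c 34 (.z 272)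
  (.c 38 (.z 280) .e)) (.c 20 (.c 12 (.z 100) (.c 44 (.z 164) .e)) .e)) .e)) (.c 34 (.c 26 (.c 25
  (.z 200) (.c 18 (.c 10 (.z 84) (.c 42 (.z 148) .e)) .e)) (.c 36 (.c 35 (.c 33 (.z 264) (.c 37
  (.z 272) .e)) (.c 20 (.c 12 (.z 100) (.c 44 (.z 164) .e)) .e)) .e)) .e))) (.c 19 (.c 35 (.c 11
  (.z 92) (.c 43 (.z 156) .e)) (.c 12 (.c 11 (.c 3 (.z 28) (.c 10 (.c 9 (.z 72) (.c 13 (.z 80)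
  .e)) .e)) (.c 20 (.c 28 (.c 4 (.z 36) (.c 36 (.z 100) .e)) (.c 18 (.c 17 (.z 136) (.c 21 (.z
  144) .e)) .e)) .e)) (.c 36 (.c 35 (.c 43 (.z 156) (.c 34 (.c 33 (.z 264) (.c 37 (.z 272) .e))
  .e)) (.c 20 (.c 28 (.c 12 (.z 100) (.c 44 (.z 164) .e)) (.c 18 (.c 17 (.z 136) (.c 21 (.z 144)
  .e)) .e)) .e)) .e))) (.c 35 (.c 19 (.c 11 (.z 92) (.c 43 (.z 156) .e)) (.c 42 (.c 43 (.c 51 (.z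
  220) (.c 44 (.c 41 (.z 328) (.c 45 (.z 336) .e)) .e)) (.c 34 (.c 26 (.c 18 (.z 148) (.c 50 (.z
  212) .e)) (.c 36 (.c 33 (.z 264) (.c 37 (.z 272) .e)) .e)) .e)) (.c 18 (.c 19 (.c 11 (.z 92)
  (.c 20 (.c 17 (.z 136) (.c 21 (.z 144) .e)) .e)) (.c 34 (.c 26 (.c 10 (.z 84) (.c 42 (.z 148)
  .e)) (.c 36 (.c 33 (.z 264) (.c 37 (.z 272) .e)) .e)) .e)) .e))) (.c 28 (.c 26 (.c 25 (.z 200)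
  (.c 29 (.z 208) .e)) (.c 21 (.c 29 (.c 30 (.z 216) (.c 37 (.c 13 (.z 108) (.c 45 (.z 172) .e))
  .e)) (.c 20 (.c 19 (.c 18 (.z 144) (.c 22 (.z 152) .e)) (.c 36 (.c 12 (.z 100) (.c 44 (.z 164)
  .e)) .e)) .e)) (.c 18 (.c 26 (.c 25 (.z 200) (.c 34 (.c 10 (.z 84) (.c 42 (.z 148) .e)) .e))
  (.c 20 (.c 19 (.c 17 (.z 136) (.c 21 (.z 144) .e)) (.c 36 (.c 12 (.z 100) (.c 44 (.z 164) .e))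
  .e)) .e)) .e))) (.c 28 (.c 26 (.c 25 (.z 200) (.c 29 (.z 208) .e)) (.c 35 (.c 19 (.c 11 (.z 92)
  (.c 43 (.z 156) .e)) (.c 36 (.c 34 (.c 33 (.z 264) (.c 37 (.z 272) .e)) (.c 20 (.c 12 (.z 100)
  (.c 44 (.z 164) .e)) .e)) .e)) .e)) (.c 26 (.c 28 (.c 25 (.z 200) (.c 29 (.z 208) .e)) (.c 35
  (.c 19 (.c 11 (.z 92) (.c 43 (.z 156) .e)) (.c 34 (.c 36 (.c 33 (.z 264) (.c 37 (.z 272) .e))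
  (.c 18 (.c 10 (.z 84) (.c 42 (.z 148) .e)) .e)) .e)) .e)) (.c 26 (.c 28 (.c 25 (.z 200) (.c 29
  (.z 208) .e)) (.c 19 (.c 35 (.c 11 (.z 92) (.c 43 (.z 156) .e)) (.c 18 (.c 20 (.c 17 (.z 136)
  (.c 21 (.z 144) .e)) (.c 34 (.c 10 (.z 84) (.c 42 (.z 148) .e)) .e)) .e)) .e)) .e)))))))) .e)

/-- Winning strategy certificate for T. -/
def treeT : Fo :=
  (.c 18 (.c 10 (.c 19 (.c 17 (.z 137) (.c 26 (.z 84) .e)) (.c 11 (.c 2 (.z 20) (.c 9 (.z 72)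
  .e)) .e)) (.c 27 (.c 26 (.c 25 (.z 201) (.c 34 (.z 148) .e)) (.c 19 (.c 11 (.z 94) (.c 20 (.z
  144) .e)) .e)) (.c 9 (.c 17 (.c 16 (.z 129) (.c 25 (.z 76) .e)) (.c 10 (.c 2 (.z 22) (.c 11 (.z
  72) .e)) .e)) (.c 17 (.c 26 (.c 10 (.z 86) (.c 19 (.z 136) .e)) (.c 9 (.c 16 (.z 129) (.c 25
  (.z 76) .e)) .e)) .e)))) .e)

/-- Winning strategy certificate for S. -/
def treeS : Fo :=
  (.c 18 (.c 26 (.c 17 (.c 9 (.z 76) (.c 27 (.z 136) .e)) (.c 19 (.c 11 (.z 213) (.c 25 (.z 201)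
  .e)) .e)) (.c 19 (.c 27 (.c 10 (.z 84) (.c 28 (.z 144) .e)) (.c 26 (.c 11 (.z 213) (.c 25 (.z
  201) .e)) .e)) (.c 10 (.c 11 (.c 3 (.z 149) (.c 17 (.z 137) .e)) (.c 19 (.c 9 (.z 72) (.c 27
  (.z 84) .e)) .e)) (.c 17 (.c 25 (.c 10 (.z 205) (.c 24 (.z 193) .e)) (.c 9 (.c 8 (.z 64) (.c 26
  (.z 76) .e)) .e)) .e)))) .e)

theorem w11I : IsWinner P41 1 1 :=
  winner_1_1 [(0, 0), (0, 1), (0, 2), (0, 3)] (by decide) treeI 6 (by decide +kernel)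
theorem w11T : IsWinner P43 1 1 :=
  winner_1_1 [(0, 0), (0, 1), (1, 1), (0, 2)] (by decide) treeT 4 (by decide +kernel)
theorem w11S : IsWinner P45 1 1 :=
  winner_1_1 [(0, 0), (0, 1), (1, 1), (1, 2)] (by decide) treeS 4 (by decide +kernel)

/-! ### Losing games -/

theorem sym_adj {f : Cell → Cell} (hf : IsSquareSymmetry f) {p q : Cell} (h : Adjacent p q) :
    Adjacent (f p) (f q) := by
  obtain ⟨e₁, e₂, s, t, h1, h2, h3⟩ := hf
  unfold Adjacent at *
  rw [h3, h3]
  rcases h1 with rfl | rfl <;> rcases h2 with rfl | rfl <;> cases s <;> simp <;> omega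

theorem sym_inj {f : Cell → Cell} (hf : IsSquareSymmetry f) : Function.Injective f := by
  obtain ⟨e₁, e₂, s, t, h1, h2, h3⟩ := hf
  intro p q h
  rw [h3, h3] at h
  apply Prod.ext <;>
  rcases h1 with rfl | rfl <;> rcases h2 with rfl | rfl <;> cases s <;> simp at h <;> omega

/-- The four neighbours of a cell. -/
def nb4 (x : Cell) : Finset Cell :=
  {(x.1 + 1, x.2), (x.1 - 1, x.2), (x.1, x.2 + 1), (x.1, x.2 - 1)}

theorem mem_nb4 {x y : Cell} (h : Adjacent x y) : y ∈ nb4 x := by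
  obtain ⟨a, b⟩ := x
  obtain ⟨c, d⟩ := y
  simp only [Adjacent] at h
  simp only [nb4, Finset.mem_insert, Finset.mem_singleton, Prod.mk.injEq]
  omega

instance : DecidableRel Adjacent := fun p q => by unfold Adjacent; infer_instance

theorem loser_3_12 {A : Finset Cell} (hA : A.card = 4)
    (hc : ∀ S ∈ A.powerset, S.Nonempty → (∀ p ∈ S, ∀ q ∈ A, Adjacent p q → q ∈ S) → S = A) :
    ¬ IsWinner A 3 12 := by
  classical
  have key : ∀ M B N : Finset Cell, (Disjoint M B ∧ ¬ PWin A M ∧ ∀ x ∈ M, nb4 x ⊆ M ∪ B) →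
      N.card = 3 → Disjoint N (M ∪ B) → ¬ PWin A (M ∪ N) := by
    rintro M B N ⟨hd, hw, hn⟩ hN hNd ⟨P, ⟨f, hf, rfl⟩, hP⟩
    have hP' : ∀ p ∈ A, f p ∈ M ∨ f p ∈ N := by
      intro p hp
      have := hP (Set.mem_image_of_mem f (Finset.mem_coe.2 hp))
      simpa using this
    have hS := hc (A.filter fun p => f p ∈ M) (by simp) (by
      by_contra hne
      rw [Finset.not_nonempty_iff_eq_empty, Finset.filter_eq_empty_iff] at hne
      have : A.image f ⊆ N := by
        intro y hy
        obtain ⟨p, hp, rfl⟩ := Finset.mem_image.1 hy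
        exact (hP' p hp).resolve_left (hne hp)
      have := Finset.card_le_card this
      rw [Finset.card_image_of_injective _ (sym_inj hf)] at this
      omega) (by
      intro p hp q hq hpq
      rw [Finset.mem_filter] at hp ⊢
      refine ⟨hq, ?_⟩
      have h1 := hn _ hp.2 (mem_nb4 (sym_adj hf hpq))
      exact (hP' q hq).resolve_right fun h2 => Finset.disjoint_left.1 hNd h2 h1)
    refine hw ⟨_, ⟨f, hf, rfl⟩, ?_⟩
    rintro _ ⟨p, hp, rfl⟩
    rw [← hS] at hp
    exact Finset.mem_coe.2 (Finset.mem_filter.1 (Finset.mem_coe.1 hp)).2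
  refine loser_of_inv (fun M B => Disjoint M B ∧ ¬ PWin A M ∧ ∀ x ∈ M, nb4 x ⊆ M ∪ B)
    ⟨by simp, ?_, by simp⟩ key ?_
  · rintro ⟨P, ⟨f, hf, rfl⟩, hP⟩
    have : A.Nonempty := Finset.card_pos.1 (by omega)
    obtain ⟨p, hp⟩ := this
    simpa using hP (Set.mem_image_of_mem f (Finset.mem_coe.2 hp))
  · intro M B N hI hN hNd
    obtain ⟨R, h1, h2, h3⟩ := exists_fill (M ∪ N ∪ B) (N.biUnion nb4 \ (M ∪ N ∪ B)) 12
      Finset.sdiff_disjoint (by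
        refine (Finset.card_le_card Finset.sdiff_subset).trans ?_
        refine (Finset.card_biUnion_le_card_mul _ _ 4 fun x _ => ?_).trans (by omega)
        exact Finset.card_le_four)
    refine ⟨R, h2, h3, ?_, key M B N hI hN hNd, ?_⟩
    · have := hI.1
      simp only [Finset.disjoint_union_left, Finset.disjoint_union_right] at *
      exact ⟨⟨this, hNd.2⟩, h3.1.1.symm, h3.1.2.symm⟩
    · intro x hx y hy
      rcases Finset.mem_union.1 hx with hx | hx
      · have := hI.2.2 x hx hy
        simp only [Finset.mem_union] at *
        tauto
      · by_cases hyX : y ∈ M ∪ N ∪ B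
        · simp only [Finset.mem_union] at *
          tauto
        · have := h1 (Finset.mem_sdiff.2 ⟨Finset.mem_biUnion.2 ⟨x, hx, hy⟩, hyX⟩)
          simp only [Finset.mem_union]
          tauto

theorem l312I : ¬ IsWinner P41 3 12 := loser_3_12 (by decide) (by decide +kernel)
theorem l312T : ¬ IsWinner P43 3 12 := loser_3_12 (by decide) (by decide +kernel)
theorem l312S : ¬ IsWinner P45 3 12 := loser_3_12 (by decide) (by decide +kernel)

/-- If the maker holds two of the four cells, the breaker holds one. -/
def Ok4 (m b : Cell → Prop) (p₀ p₁ p₂ p₃ : Cell) : Prop :=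
  (m p₀ ∧ m p₁ ∨ m p₀ ∧ m p₂ ∨ m p₀ ∧ m p₃ ∨ m p₁ ∧ m p₂ ∨ m p₁ ∧ m p₃ ∨ m p₂ ∧ m p₃) →
    b p₀ ∨ b p₁ ∨ b p₂ ∨ b p₃

/-- One round: old maker cells, new maker cells, old breaker cells, new breaker cells. -/
structure St (rule : (Cell → Prop) → (Cell → Prop) → Cell → Cell × Cell)
    (m n b r : Cell → Prop) : Prop where
  mb : ∀ x, m x → ¬ b x
  nm : ∀ x, n x → ¬ m x
  nb : ∀ x, n x → ¬ b x
  rm : ∀ x, r x → ¬ m x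
  rn : ∀ x, r x → ¬ n x
  n3 : ∀ x y z, n x → n y → n z → x = y ∨ x = z ∨ y = z
  r1 : ∀ x, n x → (m (rule (fun y => m y ∨ n y) (fun y => m y ∨ n y ∨ b y) x).1 ∨
    n (rule (fun y => m y ∨ n y) (fun y => m y ∨ n y ∨ b y) x).1 ∨
    b (rule (fun y => m y ∨ n y) (fun y => m y ∨ n y ∨ b y) x).1 ∨
    r (rule (fun y => m y ∨ n y) (fun y => m y ∨ n y ∨ b y) x).1)
  r2 : ∀ x, n x → (m (rule (fun y => m y ∨ n y) (fun y => m y ∨ n y ∨ b y) x).2 ∨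
    n (rule (fun y => m y ∨ n y) (fun y => m y ∨ n y ∨ b y) x).2 ∨
    b (rule (fun y => m y ∨ n y) (fun y => m y ∨ n y ∨ b y) x).2 ∨
    r (rule (fun y => m y ∨ n y) (fun y => m y ∨ n y ∨ b y) x).2)

theorem loser_rule {A : Finset Cell} (Fam : Cell → Cell → Cell → Cell → Prop)
    (rule : (Cell → Prop) → (Cell → Prop) → Cell → Cell × Cell)
    (K : (Cell → Prop) → (Cell → Prop) → Prop)
    (hdist : ∀ p₀ p₁ p₂ p₃, Fam p₀ p₁ p₂ p₃ →
      p₀ ≠ p₁ ∧ p₀ ≠ p₂ ∧ p₀ ≠ p₃ ∧ p₁ ≠ p₂ ∧ p₁ ≠ p₃ ∧ p₂ ≠ p₃)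
    (hfam : ∀ X, PWin A X → ∃ p₀ p₁ p₂ p₃, Fam p₀ p₁ p₂ p₃ ∧ p₀ ∈ X ∧ p₁ ∈ X ∧ p₂ ∈ X ∧ p₃ ∈ X)
    (hK0 : K (fun _ => False) (fun _ => False))
    (hK : ∀ m n b r, St rule m n b r → K m b → K (fun x => m x ∨ n x) (fun x => b x ∨ r x))
    (hJ : ∀ m n b r, St rule m n b r → K m b → K (fun x => m x ∨ n x) (fun x => b x ∨ r x) →
      ∀ p₀ p₁ p₂ p₃, Fam p₀ p₁ p₂ p₃ → Ok4 m b p₀ p₁ p₂ p₃ →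
      Ok4 (fun x => m x ∨ n x) (fun x => b x ∨ r x) p₀ p₁ p₂ p₃)
    (a : ℕ) (ha : a ≤ 2) : ¬ IsWinner A a (2 * a) := by
  classical
  have n3 : ∀ N : Finset Cell, N.card = a → ∀ x y z, x ∈ N → y ∈ N → z ∈ N →
      x = y ∨ x = z ∨ y = z := by
    intro N hN x y z hx hy hz
    by_contra! h
    have : ({x, y, z} : Finset Cell) ⊆ N := by
      intro u hu
      simp only [Finset.mem_insert, Finset.mem_singleton] at hu
      rcases hu with rfl | rfl | rfl <;> assumption
    have h1 := Finset.card_le_card this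
    rw [Finset.card_eq_three.2 ⟨x, y, z, h.1, h.2.1, h.2.2, rfl⟩] at h1
    omega
  refine loser_of_inv (fun M B => Disjoint M B ∧ K (· ∈ M) (· ∈ B) ∧
    ∀ p₀ p₁ p₂ p₃, Fam p₀ p₁ p₂ p₃ → Ok4 (· ∈ M) (· ∈ B) p₀ p₁ p₂ p₃) ?_ ?_ ?_
  · refine ⟨by simp, by simpa using hK0, fun p₀ p₁ p₂ p₃ _ => ?_⟩
    simp [Ok4]
  · rintro M B N ⟨hd, -, hJ⟩ hN hNd hW
    obtain ⟨p₀, p₁, p₂, p₃, hF, h0, h1, h2, h3⟩ := hfam _ hW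
    have hJ := hJ _ _ _ _ hF
    have hD := hdist _ _ _ _ hF
    have d1 : ∀ x, x ∈ M → x ∉ B := fun x h => Finset.disjoint_left.1 hd h
    have d2 : ∀ x, x ∈ N → x ∉ B := fun x hx h =>
      Finset.disjoint_left.1 hNd hx (Finset.mem_union_right _ h)
    have d3 : ∀ x, x ∈ M ∪ N → x ∉ B := fun x hx => (Finset.mem_union.1 hx).elim (d1 x) (d2 x)
    have e0 := n3 N hN p₀ p₁ p₂
    have e1 := n3 N hN p₀ p₁ p₃
    have e2 := n3 N hN p₀ p₂ p₃
    have e3 := n3 N hN p₁ p₂ p₃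
    have f0 := d3 _ h0
    have f1 := d3 _ h1
    have f2 := d3 _ h2
    have f3 := d3 _ h3
    rw [Finset.mem_union] at h0 h1 h2 h3
    unfold Ok4 at hJ
    clear hW n3 d1 d2 d3 hfam hK hK0 hF hdist
    grind
  · rintro M B N ⟨hd, hk, hj⟩ hN hNd
    obtain ⟨R, h1, h2, h3⟩ := exists_fill (M ∪ N ∪ B)
      (N.biUnion (fun x => {(rule (fun y => y ∈ M ∨ y ∈ N) (fun y => y ∈ M ∨ y ∈ N ∨ y ∈ B) x).1,
        (rule (fun y => y ∈ M ∨ y ∈ N) (fun y => y ∈ M ∨ y ∈ N ∨ y ∈ B) x).2}) \ (M ∪ N ∪ B))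
      (2 * a) Finset.sdiff_disjoint (by
        refine (Finset.card_le_card Finset.sdiff_subset).trans ?_
        refine (Finset.card_biUnion_le_card_mul _ _ 2 fun x _ => ?_).trans (by omega)
        exact Finset.card_le_two)
    have hR : ∀ x ∈ N, ∀ y, (y = (rule (fun y => y ∈ M ∨ y ∈ N)
        (fun y => y ∈ M ∨ y ∈ N ∨ y ∈ B) x).1 ∨ y = (rule (fun y => y ∈ M ∨ y ∈ N)
        (fun y => y ∈ M ∨ y ∈ N ∨ y ∈ B) x).2) → y ∈ M ∨ y ∈ N ∨ y ∈ B ∨ y ∈ R := by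
      intro x hx y hy
      by_cases hyX : y ∈ M ∪ N ∪ B
      · simp only [Finset.mem_union] at hyX
        tauto
      · have := h1 (Finset.mem_sdiff.2 ⟨Finset.mem_biUnion.2 ⟨x, hx, by simpa using hy⟩, hyX⟩)
        tauto
    simp only [Finset.disjoint_union_left, Finset.disjoint_union_right] at hNd h3
    have st : St rule (· ∈ M) (· ∈ N) (· ∈ B) (· ∈ R) :=
      ⟨fun x h => Finset.disjoint_left.1 hd h, fun x h => Finset.disjoint_left.1 hNd.1 h,
        fun x h => Finset.disjoint_left.1 hNd.2 h, fun x h => Finset.disjoint_left.1 h3.1.1 h,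
        fun x h => Finset.disjoint_left.1 h3.1.2 h, n3 N hN,
        fun x hx => hR x hx _ (Or.inl rfl), fun x hx => hR x hx _ (Or.inr rfl)⟩
    refine ⟨R, h2, by simp only [Finset.disjoint_union_left, Finset.disjoint_union_right]; tauto,
      ?_, ?_, ?_⟩
    · simp only [Finset.disjoint_union_left, Finset.disjoint_union_right]
      exact ⟨⟨hd, hNd.2⟩, h3.1.1.symm, h3.1.2.symm⟩
    · simpa only [Finset.mem_union] using hK _ _ _ _ st hk
    · intro p₀ p₁ p₂ p₃ hF
      simpa only [Finset.mem_union] using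
        hJ _ _ _ _ st hk (hK _ _ _ _ st hk) p₀ p₁ p₂ p₃ hF (hj _ _ _ _ hF)

/-- Images of the cells under a symmetry. -/
def sym4 (e₁ e₂ : ℤ) (s : Bool) (t p : Cell) : Cell :=
  if s then (e₁ * p.2 + t.1, e₂ * p.1 + t.2) else (e₁ * p.1 + t.1, e₂ * p.2 + t.2)

theorem PWin_cases {A X : Finset Cell} (h : PWin A X) :
    ∃ (e₁ e₂ : ℤ) (s : Bool) (t : Cell), (e₁ = 1 ∨ e₁ = -1) ∧ (e₂ = 1 ∨ e₂ = -1) ∧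
      ∀ p ∈ A, sym4 e₁ e₂ s t p ∈ X := by
  obtain ⟨P, ⟨f, ⟨e₁, e₂, s, t, h1, h2, h3⟩, rfl⟩, hP⟩ := h
  refine ⟨e₁, e₂, s, t, h1, h2, fun p hp => ?_⟩
  have := hP (Set.mem_image_of_mem f (Finset.mem_coe.2 hp))
  rw [h3] at this
  exact_mod_cast this

/-- Lines of four cells. -/
def FamI (p₀ p₁ p₂ p₃ : Cell) : Prop := ∃ i j : ℤ,
  (p₀ = (i, j) ∧ p₁ = (i + 1, j) ∧ p₂ = (i + 2, j) ∧ p₃ = (i + 3, j)) ∨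
  (p₀ = (i, j) ∧ p₁ = (i, j + 1) ∧ p₂ = (i, j + 2) ∧ p₃ = (i, j + 3))

open Classical in
/-- The breaker's reply against the I-tetromino. -/
noncomputable def ruleI (_ X : Cell → Prop) (x : Cell) : Cell × Cell :=
  (if X (x.1 + 1, x.2) then (x.1 - 1, x.2) else (x.1 + 1, x.2),
    if X (x.1, x.2 + 1) then (x.1, x.2 - 1) else (x.1, x.2 + 1))

/-- The invariant against the I-tetromino. -/
def KI (m b : Cell → Prop) : Prop := ∀ i j : ℤ, m (i, j) →
  (m (i + 1, j) ∨ b (i + 1, j)) ∧ (m (i, j + 1) ∨ b (i, j + 1)) ∧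
  (m (i + 1, j) → m (i - 1, j) ∨ b (i - 1, j)) ∧ (m (i, j + 1) → m (i, j - 1) ∨ b (i, j - 1))

theorem lI (a : ℕ) (ha : a ≤ 2) : ¬ IsWinner P41 a (2 * a) := by
  refine loser_rule FamI ruleI KI ?_ ?_ ?_ ?_ ?_ a ha
  · rintro _ _ _ _ ⟨i, j, ⟨rfl, rfl, rfl, rfl⟩ | ⟨rfl, rfl, rfl, rfl⟩⟩ <;> simp
  · intro X h
    obtain ⟨e₁, e₂, s, t, h1, h2, h3⟩ := PWin_cases h
    have h0 := h3 (0, 0) (by decide)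
    have h4 := h3 (0, 1) (by decide)
    have h5 := h3 (0, 2) (by decide)
    have h6 := h3 (0, 3) (by decide)
    clear h3
    rcases h1 with rfl | rfl <;> rcases h2 with rfl | rfl <;> cases s
    · exact ⟨_, _, _, _, ⟨t.1, t.2, Or.inr (by
        refine ⟨?_, ?_, ?_, ?_⟩ <;> simp [sym4] <;> omega)⟩, h0, h4, h5, h6⟩
    · exact ⟨_, _, _, _, ⟨t.1, t.2, Or.inl (by
        refine ⟨?_, ?_, ?_, ?_⟩ <;> simp [sym4] <;> omega)⟩, h0, h4, h5, h6⟩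
    · exact ⟨_, _, _, _, ⟨t.1, t.2 - 3, Or.inr (by
        refine ⟨?_, ?_, ?_, ?_⟩ <;> simp [sym4] <;> omega)⟩, h6, h5, h4, h0⟩
    · exact ⟨_, _, _, _, ⟨t.1, t.2, Or.inl (by
        refine ⟨?_, ?_, ?_, ?_⟩ <;> simp [sym4] <;> omega)⟩, h0, h4, h5, h6⟩
    · exact ⟨_, _, _, _, ⟨t.1, t.2, Or.inr (by
        refine ⟨?_, ?_, ?_, ?_⟩ <;> simp [sym4] <;> omega)⟩, h0, h4, h5, h6⟩
    · exact ⟨_, _, _, _, ⟨t.1 - 3, t.2, Or.inl (by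
        refine ⟨?_, ?_, ?_, ?_⟩ <;> simp [sym4] <;> omega)⟩, h6, h5, h4, h0⟩
    · exact ⟨_, _, _, _, ⟨t.1, t.2 - 3, Or.inr (by
        refine ⟨?_, ?_, ?_, ?_⟩ <;> simp [sym4] <;> omega)⟩, h6, h5, h4, h0⟩
    · exact ⟨_, _, _, _, ⟨t.1 - 3, t.2, Or.inl (by
        refine ⟨?_, ?_, ?_, ?_⟩ <;> simp [sym4] <;> omega)⟩, h6, h5, h4, h0⟩
  · intro i j h
    exact h.elim
  · intro m n b r st hk i j hx
    have k := hk i j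
    have r1 := st.r1 (i, j)
    have r2 := st.r2 (i, j)
    have c1 := st.nm (i + 1, j)
    have c2 := st.nm (i, j + 1)
    have c3 := st.nb (i + 1, j)
    have c4 := st.nb (i, j + 1)
    simp only [ruleI] at r1 r2
    clear st hk
    grind
  · rintro m n b r st - hk _ _ _ _ ⟨i, j, ⟨rfl, rfl, rfl, rfl⟩ | ⟨rfl, rfl, rfl, rfl⟩⟩
    · have k0 := hk i j
      have k1 := hk (i + 1) j
      have k2 := hk (i + 2) j
      simp only [add_assoc, add_sub_assoc] at k0 k1 k2
      norm_num at k0 k1 k2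
      have d0 := st.n3 (i, j) (i + 1, j) (i + 2, j)
      have d1 := st.n3 (i, j) (i + 1, j) (i + 3, j)
      have d2 := st.n3 (i, j) (i + 2, j) (i + 3, j)
      have d3 := st.n3 (i + 1, j) (i + 2, j) (i + 3, j)
      simp at d0 d1 d2 d3
      clear st hk
      unfold Ok4
      grind
    · have k0 := hk i j
      have k1 := hk i (j + 1)
      have k2 := hk i (j + 2)
      simp only [add_assoc, add_sub_assoc] at k0 k1 k2
      norm_num at k0 k1 k2
      have d0 := st.n3 (i, j) (i, j + 1) (i, j + 2)
      have d1 := st.n3 (i, j) (i, j + 1) (i, j + 3)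
      have d2 := st.n3 (i, j) (i, j + 2) (i, j + 3)
      have d3 := st.n3 (i, j + 1) (i, j + 2) (i, j + 3)
      simp at d0 d1 d2 d3
      clear st hk
      unfold Ok4
      grind

/-- T-shapes, given by the centre and three neighbours of it. -/
def FamT (p₀ p₁ p₂ p₃ : Cell) : Prop := ∃ i j : ℤ, p₀ = (i, j) ∧
  ((p₁ = (i + 1, j) ∧ p₂ = (i, j + 1) ∧ p₃ = (i - 1, j)) ∨
  (p₁ = (i + 1, j) ∧ p₂ = (i, j + 1) ∧ p₃ = (i, j - 1)) ∨
  (p₁ = (i + 1, j) ∧ p₂ = (i - 1, j) ∧ p₃ = (i, j - 1)) ∨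
  (p₁ = (i, j + 1) ∧ p₂ = (i - 1, j) ∧ p₃ = (i, j - 1)))

open Classical in
/-- The breaker's reply against the T-tetromino. -/
noncomputable def ruleT (M X : Cell → Prop) (x : Cell) : Cell × Cell :=
  if X (x.1 + 1, x.2) ∨ M (x.1 + 1, x.2 - 1) then
    if X (x.1, x.2 + 1) then ((x.1, x.2 - 1), (x.1 - 1, x.2))
    else if X (x.1, x.2 - 1) then ((x.1, x.2 + 1), (x.1 - 1, x.2))
    else ((x.1, x.2 + 1), (x.1, x.2 - 1))
  else
    if X (x.1, x.2 + 1) then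
      if X (x.1 - 1, x.2) then ((x.1 + 1, x.2), (x.1, x.2 - 1))
      else ((x.1 + 1, x.2), (x.1 - 1, x.2))
    else ((x.1 + 1, x.2), (x.1, x.2 + 1))

/-- The invariant against the T-tetromino. -/
def KT (m b : Cell → Prop) : Prop := ∀ i j : ℤ, m (i, j) →
  (m (i + 1, j) ∨ b (i + 1, j)) ∧ (m (i, j + 1) ∨ b (i, j + 1))

theorem ruleT_spec {m n b r : Cell → Prop} (st : St ruleT m n b r) (i j : ℤ) (h : n (i, j)) :
    let X : Cell → Prop := fun y => m y ∨ n y ∨ b y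
    let Y : Cell → Prop := fun y => m y ∨ n y ∨ b y ∨ r y
    ((X (i + 1, j) ∨ m (i + 1, j - 1) ∨ n (i + 1, j - 1)) ∧
      (X (i, j + 1) ∧ Y (i, j - 1) ∧ Y (i - 1, j) ∨
      ¬ X (i, j + 1) ∧ X (i, j - 1) ∧ Y (i, j + 1) ∧ Y (i - 1, j) ∨
      ¬ X (i, j + 1) ∧ ¬ X (i, j - 1) ∧ Y (i, j + 1) ∧ Y (i, j - 1))) ∨
    (¬ (X (i + 1, j) ∨ m (i + 1, j - 1) ∨ n (i + 1, j - 1)) ∧ Y (i + 1, j) ∧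
      (X (i, j + 1) ∧ X (i - 1, j) ∧ Y (i, j - 1) ∨
      X (i, j + 1) ∧ ¬ X (i - 1, j) ∧ Y (i - 1, j) ∨ ¬ X (i, j + 1) ∧ Y (i, j + 1))) := by
  intro X Y
  have h1 := st.r1 _ h
  have h2 := st.r2 _ h
  change Y _ at h1
  change Y _ at h2
  change Y (ruleT (fun y => m y ∨ n y) X (i, j)).1 at h1
  change Y (ruleT (fun y => m y ∨ n y) X (i, j)).2 at h2
  clear_value X Y
  unfold ruleT at h1 h2
  split_ifs at h1 h2 <;> tauto

theorem lT (a : ℕ) (ha : a ≤ 2) : ¬ IsWinner P43 a (2 * a) := by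
  refine loser_rule FamT ruleT KT ?_ ?_ ?_ ?_ ?_ a ha
  · rintro _ _ _ _ ⟨i, j, rfl, ⟨rfl, rfl, rfl⟩ | ⟨rfl, rfl, rfl⟩ | ⟨rfl, rfl, rfl⟩ |
      ⟨rfl, rfl, rfl⟩⟩ <;> simp <;> omega
  · intro X h
    obtain ⟨e₁, e₂, s, t, h1, h2, h3⟩ := PWin_cases h
    have h0 := h3 (0, 1) (by decide)
    have h4 := h3 (0, 0) (by decide)
    have h5 := h3 (1, 1) (by decide)
    have h6 := h3 (0, 2) (by decide)
    clear h3
    rcases h1 with rfl | rfl <;> rcases h2 with rfl | rfl <;> cases s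
    · refine ⟨_, _, _, _, ⟨t.1 + 0, t.2 + 1, ?_, Or.inr (Or.inl (by
        refine ⟨?_, ?_, ?_⟩ <;> simp [sym4] <;> omega))⟩, h0, h5, h6, h4⟩
      simp [sym4] <;> omega
    · refine ⟨_, _, _, _, ⟨t.1 + 1, t.2 + 0, ?_, Or.inl (by
        refine ⟨?_, ?_, ?_⟩ <;> simp [sym4] <;> omega)⟩, h0, h6, h5, h4⟩
      simp [sym4] <;> omega
    · refine ⟨_, _, _, _, ⟨t.1 + 0, t.2 - 1, ?_, Or.inr (Or.inl (by
        refine ⟨?_, ?_, ?_⟩ <;> simp [sym4] <;> omega))⟩, h0, h5, h4, h6⟩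
      simp [sym4] <;> omega
    · refine ⟨_, _, _, _, ⟨t.1 + 1, t.2 + 0, ?_, Or.inr (Or.inr (Or.inl (by
        refine ⟨?_, ?_, ?_⟩ <;> simp [sym4] <;> omega)))⟩, h0, h6, h4, h5⟩
      simp [sym4] <;> omega
    · refine ⟨_, _, _, _, ⟨t.1 + 0, t.2 + 1, ?_, Or.inr (Or.inr (Or.inr (by
        refine ⟨?_, ?_, ?_⟩ <;> simp [sym4] <;> omega)))⟩, h0, h6, h5, h4⟩
      simp [sym4] <;> omega
    · refine ⟨_, _, _, _, ⟨t.1 - 1, t.2 + 0, ?_, Or.inl (by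
        refine ⟨?_, ?_, ?_⟩ <;> simp [sym4] <;> omega)⟩, h0, h4, h5, h6⟩
      simp [sym4] <;> omega
    · refine ⟨_, _, _, _, ⟨t.1 + 0, t.2 - 1, ?_, Or.inr (Or.inr (Or.inr (by
        refine ⟨?_, ?_, ?_⟩ <;> simp [sym4] <;> omega)))⟩, h0, h4, h5, h6⟩
      simp [sym4] <;> omega
    · refine ⟨_, _, _, _, ⟨t.1 - 1, t.2 + 0, ?_, Or.inr (Or.inr (Or.inl (by
        refine ⟨?_, ?_, ?_⟩ <;> simp [sym4] <;> omega)))⟩, h0, h4, h6, h5⟩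
      simp [sym4] <;> omega
  · intro i j h
    exact h.elim
  · intro m n b r st hk i j hx
    have k := hk i j
    have k' := hk (i + 1) (j - 1)
    have r1 := ruleT_spec st i j
    have s1 := ruleT_spec st (i + 1) (j - 1)
    simp only [sub_add_cancel, add_sub_cancel_right] at k' r1 s1
    clear st hk
    grind (splits := 30)
  · rintro m n b r st hko hk _ _ _ _ ⟨i, j, rfl, hF⟩
    have koc := hko i j
    have knc := hk i j
    have nmc := st.nm (i, j)
    have nbc := st.nb (i, j)
    have koR := hko (i + 1) j
    have knR := hk (i + 1) j
    have nmR := st.nm (i + 1, j)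
    have nbR := st.nb (i + 1, j)
    have koU := hko i (j + 1)
    have knU := hk i (j + 1)
    have nmU := st.nm (i, j + 1)
    have nbU := st.nb (i, j + 1)
    have koL := hko (i - 1) j
    have knL := hk (i - 1) j
    have nmL := st.nm (i - 1, j)
    have nbL := st.nb (i - 1, j)
    have koD := hko i (j - 1)
    have knD := hk i (j - 1)
    have nmD := st.nm (i, j - 1)
    have nbD := st.nb (i, j - 1)
    have r1c := ruleT_spec st i j
    have r1R := ruleT_spec st (i + 1) j
    have r1U := ruleT_spec st i (j + 1)
    have tcRU := st.n3 (i, j) (i + 1, j) (i, j + 1)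
    have tcRL := st.n3 (i, j) (i + 1, j) (i - 1, j)
    have tcRD := st.n3 (i, j) (i + 1, j) (i, j - 1)
    have tcUL := st.n3 (i, j) (i, j + 1) (i - 1, j)
    have tcUD := st.n3 (i, j) (i, j + 1) (i, j - 1)
    have tcLD := st.n3 (i, j) (i - 1, j) (i, j - 1)
    have tRUL := st.n3 (i + 1, j) (i, j + 1) (i - 1, j)
    have tRUD := st.n3 (i + 1, j) (i, j + 1) (i, j - 1)
    have tRLD := st.n3 (i + 1, j) (i - 1, j) (i, j - 1)
    have tULD := st.n3 (i, j + 1) (i - 1, j) (i, j - 1)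
    clear st hk hko
    simp only [sub_add_cancel, add_sub_cancel_right] at koc knc koR knR koU knU koL knL koD knD r1c r1R r1U
    simp only [Prod.mk.injEq] at tcRU tcRL tcRD tcUL tcUD tcLD tRUL tRUD tRLD tULD
    rcases hF with ⟨rfl, rfl, rfl⟩ | ⟨rfl, rfl, rfl⟩ | ⟨rfl, rfl, rfl⟩ | ⟨rfl, rfl, rfl⟩
    · unfold Ok4
      grind (splits := 30)
    · unfold Ok4
      grind (splits := 30)
    · unfold Ok4
      grind (splits := 30)
    · unfold Ok4
      grind (splits := 30)

/-- A cell property `Q x (x+v) (x-v) (x+w) (x-w) (x+v+w) (x+v-w) (x-v+w) (x-v-w)` holds at all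
cells, where the axis `v` alternates like a checkerboard in the coordinates `g`. -/
def Loc (Q : Cell → Cell → Cell → Cell → Cell → Cell → Cell → Cell → Cell → Prop)
    (g : ℤ → ℤ → Cell) : Prop := ∀ a c : ℤ,
  (Even (a + c) → Q (g a c) (g (a + 1) c) (g (a - 1) c) (g a (c + 1)) (g a (c - 1))
    (g (a + 1) (c + 1)) (g (a + 1) (c - 1)) (g (a - 1) (c + 1)) (g (a - 1) (c - 1))) ∧
  (¬ Even (a + c) → Q (g a c) (g a (c + 1)) (g a (c - 1)) (g (a + 1) c) (g (a - 1) c)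
    (g (a + 1) (c + 1)) (g (a - 1) (c + 1)) (g (a + 1) (c - 1)) (g (a - 1) (c - 1)))

/-- Coordinate systems respecting the checkerboard. -/
def Good (g : ℤ → ℤ → Cell) : Prop := ∃ i j s t : ℤ, (s = 1 ∨ s = -1) ∧ (t = 1 ∨ t = -1) ∧
  ((Even (i + j) ∧ ∀ a c, g a c = (i + s * a, j + t * c)) ∨
   (¬ Even (i + j) ∧ ∀ a c, g a c = (i + t * c, j + s * a)))

theorem Loc.pull {Q : Cell → Cell → Cell → Cell → Cell → Cell → Cell → Cell → Cell → Prop}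
    (h : Loc Q Prod.mk)
    (s1 : ∀ x x1 x2 w1 w2 c11 c12 c21 c22, Q x x1 x2 w1 w2 c11 c12 c21 c22 →
      Q x x2 x1 w1 w2 c21 c22 c11 c12)
    (s2 : ∀ x x1 x2 w1 w2 c11 c12 c21 c22, Q x x1 x2 w1 w2 c11 c12 c21 c22 →
      Q x x1 x2 w2 w1 c12 c11 c22 c21) {g : ℤ → ℤ → Cell} (hg : Good g) : Loc Q g := by
  have ev : ∀ x y s t : ℤ, (s = 1 ∨ s = -1) → (t = 1 ∨ t = -1) → Even (x + y) →
      Q (x, y) (x + s, y) (x - s, y) (x, y + t) (x, y - t)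
        (x + s, y + t) (x + s, y - t) (x - s, y + t) (x - s, y - t) := by
    intro x y s t hs ht he
    have q := (h x y).1 he
    rcases hs with rfl | rfl <;> rcases ht with rfl | rfl <;>
      try simp only [sub_neg_eq_add, ← sub_eq_add_neg]
    · exact q
    · exact s2 _ _ _ _ _ _ _ _ _ q
    · exact s1 _ _ _ _ _ _ _ _ _ q
    · exact s1 _ _ _ _ _ _ _ _ _ (s2 _ _ _ _ _ _ _ _ _ q)
  have od : ∀ x y s t : ℤ, (s = 1 ∨ s = -1) → (t = 1 ∨ t = -1) → ¬ Even (x + y) →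
      Q (x, y) (x, y + t) (x, y - t) (x + s, y) (x - s, y)
        (x + s, y + t) (x - s, y + t) (x + s, y - t) (x - s, y - t) := by
    intro x y s t hs ht he
    have q := (h x y).2 he
    rcases hs with rfl | rfl <;> rcases ht with rfl | rfl <;>
      try simp only [sub_neg_eq_add, ← sub_eq_add_neg]
    · exact q
    · exact s1 _ _ _ _ _ _ _ _ _ q
    · exact s2 _ _ _ _ _ _ _ _ _ q
    · exact s1 _ _ _ _ _ _ _ _ _ (s2 _ _ _ _ _ _ _ _ _ q)
  obtain ⟨i, j, s, t, hs, ht, ⟨he, hg⟩ | ⟨he, hg⟩⟩ := hg <;> intro a c <;>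
    simp only [hg, mul_add, mul_sub, mul_one, ← add_assoc, ← add_sub_assoc] <;>
    refine ⟨fun h' => ?_, fun h' => ?_⟩
  · refine ev (i + s * a) (j + t * c) s t hs ht ?_
    rw [Int.even_iff] at *
    rcases hs with rfl | rfl <;> rcases ht with rfl | rfl <;> omega
  · refine od (i + s * a) (j + t * c) s t hs ht ?_
    rw [Int.even_iff] at *
    rcases hs with rfl | rfl <;> rcases ht with rfl | rfl <;> omega
  · refine od (i + t * c) (j + s * a) t s ht hs ?_
    rw [Int.even_iff] at *
    rcases hs with rfl | rfl <;> rcases ht with rfl | rfl <;> omega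
  · refine ev (i + t * c) (j + s * a) t s ht hs ?_
    rw [Int.even_iff] at *
    rcases hs with rfl | rfl <;> rcases ht with rfl | rfl <;> omega

/-- S-shapes. -/
def FamS (p₀ p₁ p₂ p₃ : Cell) : Prop := ∃ g : ℤ → ℤ → Cell, Good g ∧
  p₀ = g (-1) 1 ∧ p₁ = g 0 1 ∧ p₂ = g 0 0 ∧ p₃ = g 1 0

open Classical in
/-- The breaker's reply in the corner case. -/
noncomputable def cornerS (X : Cell → Prop) (q q' z : Cell) : Cell × Cell :=
  if X q then (q', z) else if X q' then (q, z) else (q, q')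

open Classical in
/-- The breaker's reply against the S-tetromino, relative to an axis. -/
noncomputable def axisS (M X : Cell → Prop) (x1 x2 w1 w2 c11 c12 c21 c22 : Cell) : Cell × Cell :=
  if M x1 then if M x2 then (w1, w2) else cornerS X c21 c22 x2
  else if M x2 then cornerS X c11 c12 x1 else (x1, x2)

open Classical in
/-- The breaker's reply against the S-tetromino. -/
noncomputable def ruleS (M X : Cell → Prop) (x : Cell) : Cell × Cell :=
  if Even (x.1 + x.2) then
    axisS M X (x.1 + 1, x.2) (x.1 - 1, x.2) (x.1, x.2 + 1) (x.1, x.2 - 1)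
      (x.1 + 1, x.2 + 1) (x.1 + 1, x.2 - 1) (x.1 - 1, x.2 + 1) (x.1 - 1, x.2 - 1)
  else
    axisS M X (x.1, x.2 + 1) (x.1, x.2 - 1) (x.1 + 1, x.2) (x.1 - 1, x.2)
      (x.1 + 1, x.2 + 1) (x.1 - 1, x.2 + 1) (x.1 + 1, x.2 - 1) (x.1 - 1, x.2 - 1)

/-- What the reply achieves. -/
def SP (N M X Y : Cell → Prop) (x x1 x2 w1 w2 c11 c12 c21 c22 : Cell) : Prop := N x →
  (¬ M x1 → ¬ M x2 → Y x1 ∧ Y x2) ∧ (M x1 → M x2 → Y w1 ∧ Y w2) ∧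
  (M x1 → ¬ M x2 → Y c21 ∧ Y c22 ∧ (X c21 ∨ X c22 → Y x2)) ∧
  (M x2 → ¬ M x1 → Y c11 ∧ Y c12 ∧ (X c11 ∨ X c12 → Y x1))

/-- The local invariant against the S-tetromino. -/
def KP (M Y : Cell → Prop) (x x1 x2 _w1 _w2 c11 c12 c21 c22 : Cell) : Prop := M x →
  (Y x1 ∨ M x2 ∧ Y c11 ∧ Y c12) ∧ (Y x2 ∨ M x1 ∧ Y c21 ∧ Y c22)

/-- The invariant against the S-tetromino. -/
def KS (m b : Cell → Prop) : Prop := Loc (KP m (fun x => m x ∨ b x)) Prod.mk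

theorem axisS_spec {M X Y : Cell → Prop} (hX : ∀ x, X x → Y x) {N : Cell → Prop} {x x1 x2 w1 w2 c11 c12 c21 c22 : Cell}
    (h1 : N x → Y (axisS M X x1 x2 w1 w2 c11 c12 c21 c22).1)
    (h2 : N x → Y (axisS M X x1 x2 w1 w2 c11 c12 c21 c22).2) :
    SP N M X Y x x1 x2 w1 w2 c11 c12 c21 c22 := by
  intro hn
  have h1 := h1 hn
  have h2 := h2 hn
  have e1 := hX c11
  have e2 := hX c12
  have e3 := hX c21
  have e4 := hX c22
  clear hX
  unfold axisS cornerS at h1 h2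
  split_ifs at h1 h2 <;> grind (splits := 20)

theorem ruleS_spec {m n b r : Cell → Prop} (st : St ruleS m n b r) :
    Loc (SP n (fun y => m y ∨ n y) (fun y => m y ∨ n y ∨ b y) (fun y => m y ∨ n y ∨ b y ∨ r y))
      Prod.mk := by
  intro a c
  have r1 := st.r1 (a, c)
  have r2 := st.r2 (a, c)
  unfold ruleS at r1 r2
  refine ⟨fun h => ?_, fun h => ?_⟩
  · simp only [h, if_true] at r1 r2
    exact axisS_spec (by tauto) r1 r2
  · simp only [h, if_false] at r1 r2
    exact axisS_spec (by tauto) r1 r2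

theorem SP_KP {m n b r : Cell → Prop} {x x1 x2 w1 w2 c11 c12 c21 c22 : Cell}
    (h : SP n (fun y => m y ∨ n y) (fun y => m y ∨ n y ∨ b y) (fun y => m y ∨ n y ∨ b y ∨ r y)
      x x1 x2 w1 w2 c11 c12 c21 c22)
    (h' : KP m (fun x => m x ∨ b x) x x1 x2 w1 w2 c11 c12 c21 c22) :
    KP (fun x => m x ∨ n x) (fun x => (m x ∨ n x) ∨ (b x ∨ r x)) x x1 x2 w1 w2 c11 c12 c21 c22 := by
  unfold SP at h
  unfold KP at h' ⊢
  grind (splits := 30)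

set_option maxHeartbeats 4000000 in
theorem coreS {m n b r : Cell → Prop} (st : St ruleS m n b r) (g : ℤ → ℤ → Cell)
    (hS : Loc (SP n (fun y => m y ∨ n y) (fun y => m y ∨ n y ∨ b y)
      (fun y => m y ∨ n y ∨ b y ∨ r y)) g)
    (hK : Loc (KP m (fun x => m x ∨ b x)) g)
    (hK' : Loc (KP (fun x => m x ∨ n x) (fun x => (m x ∨ n x) ∨ (b x ∨ r x))) g)
    (n0 : ¬ (n (g 0 1) ∧ n (g 0 0) ∧ n (g 1 0)))
    (n1 : ¬ (n (g (-1) 1) ∧ n (g 0 0) ∧ n (g 1 0)))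
    (n2 : ¬ (n (g (-1) 1) ∧ n (g 0 1) ∧ n (g 1 0)))
    (n3 : ¬ (n (g (-1) 1) ∧ n (g 0 1) ∧ n (g 0 0)))
    (ho : Ok4 m b (g (-1) 1) (g 0 1) (g 0 0) (g 1 0)) :
    Ok4 (fun x => m x ∨ n x) (fun x => b x ∨ r x) (g (-1) 1) (g 0 1) (g 0 0) (g 1 0) := by
  have s0 := (hS (-1) 1).1 (by decide)
  have k0 := (hK (-1) 1).1 (by decide)
  have l0 := (hK' (-1) 1).1 (by decide)
  have s1 := (hS 0 1).2 (by decide)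
  have k1 := (hK 0 1).2 (by decide)
  have l1 := (hK' 0 1).2 (by decide)
  have s2 := (hS 0 0).1 (by decide)
  have k2 := (hK 0 0).1 (by decide)
  have l2 := (hK' 0 0).1 (by decide)
  have s3 := (hS 1 0).2 (by decide)
  have k3 := (hK 1 0).2 (by decide)
  have l3 := (hK' 1 0).2 (by decide)
  have sz := (hS (-1) 0).2 (by decide)
  have kz := (hK (-1) 0).2 (by decide)
  have lz := (hK' (-1) 0).2 (by decide)
  have nmm10 := st.nm (g (-1) 0)
  have nbm10 := st.nb (g (-1) 0)
  have mbm10 := st.mb (g (-1) 0)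
  have nmm11 := st.nm (g (-1) 1)
  have nbm11 := st.nb (g (-1) 1)
  have mbm11 := st.mb (g (-1) 1)
  have nm00 := st.nm (g 0 0)
  have nb00 := st.nb (g 0 0)
  have mb00 := st.mb (g 0 0)
  have nm01 := st.nm (g 0 1)
  have nb01 := st.nb (g 0 1)
  have mb01 := st.mb (g 0 1)
  have nm10 := st.nm (g 1 0)
  have nb10 := st.nb (g 1 0)
  have mb10 := st.mb (g 1 0)
  have nm11 := st.nm (g 1 1)
  have nb11 := st.nb (g 1 1)
  have mb11 := st.mb (g 1 1)
  clear hS hK hK' st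
  norm_num [SP, KP, -not_or] at s0 k0 l0 s1 k1 l1 s2 k2 l2 s3 k3 l3 sz kz lz
  intro hp
  by_contra hb
  simp only [not_or] at hb
  obtain ⟨⟨b0, r0⟩, ⟨b1, r1⟩, ⟨b2, r2⟩, ⟨b3, r3⟩⟩ := hb
  unfold Ok4 at ho
  simp only [b0, b1, b2, b3, r0, r1, r2, r3, or_false] at *
  by_cases m0 : m (g (-1) 1) <;> by_cases m1 : m (g 0 1) <;> by_cases m2 : m (g 0 0) <;>
    by_cases m3 : m (g 1 0) <;> simp only [m0, m1, m2, m3, true_and, and_true, true_or, or_true,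
      false_or, or_false, and_false, false_and, not_true_eq_false, true_imp_iff, false_imp_iff] at ho hp
  all_goals
    by_cases n0 : n (g (-1) 1) <;> by_cases n1 : n (g 0 1) <;> by_cases n2 : n (g 0 0) <;>
    by_cases n3 : n (g 1 0) <;> first | (exfalso; clear s0 k0 l0 s1 k1 l1 s2 k2 l2 s3 k3 l3 sz kz lz; simp_all only [not_true_eq_false, and_self, and_true, true_and, and_false, false_and, or_self, or_false, false_or, imp_false]; done) | (simp only [m0, m1, m2, m3, n0, n1, n2, n3, true_or, or_true, or_false, false_or, true_and, and_true, and_false, false_and, true_imp_iff, false_imp_iff, imp_false, not_true_eq_false, not_false_eq_true] at * <;> grind (splits := 30))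

theorem lS (a : ℕ) (ha : a ≤ 2) : ¬ IsWinner P45 a (2 * a) := by
  have hdist : ∀ p₀ p₁ p₂ p₃, FamS p₀ p₁ p₂ p₃ →
      p₀ ≠ p₁ ∧ p₀ ≠ p₂ ∧ p₀ ≠ p₃ ∧ p₁ ≠ p₂ ∧ p₁ ≠ p₃ ∧ p₂ ≠ p₃ := by
    rintro _ _ _ _ ⟨g, ⟨i, j, s, t, hs, ht, ⟨-, hg⟩ | ⟨-, hg⟩⟩, rfl, rfl, rfl, rfl⟩ <;>
      simp only [hg, ne_eq, Prod.mk.injEq] <;>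
      rcases hs with rfl | rfl <;> rcases ht with rfl | rfl <;> omega
  have kp1 : ∀ M Y x x1 x2 w1 w2 c11 c12 c21 c22, KP M Y x x1 x2 w1 w2 c11 c12 c21 c22 →
      KP M Y x x2 x1 w1 w2 c21 c22 c11 c12 := by
    unfold KP
    tauto
  have kp2 : ∀ M Y x x1 x2 w1 w2 c11 c12 c21 c22, KP M Y x x1 x2 w1 w2 c11 c12 c21 c22 →
      KP M Y x x1 x2 w2 w1 c12 c11 c22 c21 := by
    unfold KP
    tauto
  have hK : ∀ m n b r, St ruleS m n b r → KS m b → KS (fun x => m x ∨ n x) (fun x => b x ∨ r x) := by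
    intro m n b r st hk a c
    have s := ruleS_spec st a c
    have k := hk a c
    exact ⟨fun h => SP_KP (s.1 h) (k.1 h), fun h => SP_KP (s.2 h) (k.2 h)⟩
  refine loser_rule FamS ruleS KS hdist ?_ ?_ hK ?_ a ha
  · intro X h
    obtain ⟨e₁, e₂, s, t, h1, h2, h3⟩ := PWin_cases h
    have h0 := h3 (0, 0) (by decide)
    have h4 := h3 (0, 1) (by decide)
    have h5 := h3 (1, 1) (by decide)
    have h6 := h3 (1, 2) (by decide)
    clear h3
    have h1' : -e₁ = 1 ∨ -e₁ = -1 := by omega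
    have h2' : -e₂ = 1 ∨ -e₂ = -1 := by omega
    cases s
    · by_cases hp : Even (e₁ + t.1 + (e₂ + t.2))
      · refine ⟨_, _, _, _, ⟨fun a c => (t.1 + e₁ * c, e₂ + t.2 + -e₂ * a),
          ⟨t.1, e₂ + t.2, -e₂, e₁, h2', h1, Or.inr ⟨?_, fun _ _ => rfl⟩⟩, ?_⟩, h6, h5, h4, h0⟩
        · rw [Int.even_iff] at *
          omega
        · refine ⟨?_, ?_, ?_, ?_⟩ <;> simp [sym4] <;> omega
      · refine ⟨_, _, _, _, ⟨fun a c => (e₁ + t.1 + -e₁ * c, e₂ + t.2 + e₂ * a),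
          ⟨e₁ + t.1, e₂ + t.2, e₂, -e₁, h2, h1', Or.inr ⟨hp, fun _ _ => rfl⟩⟩, ?_⟩,
          h0, h4, h5, h6⟩
        refine ⟨?_, ?_, ?_, ?_⟩ <;> simp [sym4] <;> omega
    · by_cases hp : Even (e₁ + t.1 + (e₂ + t.2))
      · refine ⟨_, _, _, _, ⟨fun a c => (e₁ + t.1 + e₁ * a, e₂ + t.2 + -e₂ * c),
          ⟨e₁ + t.1, e₂ + t.2, e₁, -e₂, h1, h2', Or.inl ⟨hp, fun _ _ => rfl⟩⟩, ?_⟩,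
          h0, h4, h5, h6⟩
        refine ⟨?_, ?_, ?_, ?_⟩ <;> simp [sym4] <;> omega
      · refine ⟨_, _, _, _, ⟨fun a c => (e₁ + t.1 + -e₁ * a, t.2 + e₂ * c),
          ⟨e₁ + t.1, t.2, -e₁, e₂, h1', h2, Or.inl ⟨?_, fun _ _ => rfl⟩⟩, ?_⟩, h6, h5, h4, h0⟩
        · rw [Int.even_iff] at *
          omega
        · refine ⟨?_, ?_, ?_, ?_⟩ <;> simp [sym4] <;> omega
  · intro a c
    exact ⟨fun _ h => h.elim, fun _ h => h.elim⟩
  · intro m n b r st hk hk' p₀ p₁ p₂ p₃ hF ho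
    have hd := hdist _ _ _ _ hF
    obtain ⟨g, hg, rfl, rfl, rfl, rfl⟩ := hF
    have n3 := st.n3
    refine coreS st g ((ruleS_spec st).pull ?_ ?_ hg) (Loc.pull hk (kp1 _ _) (kp2 _ _) hg)
      (Loc.pull hk' (kp1 _ _) (kp2 _ _) hg) ?_ ?_ ?_ ?_ ho
    · unfold SP
      intro x x1 x2 w1 w2 c11 c12 c21 c22 h hn
      exact ⟨fun a b => ((h hn).1 b a).symm, fun a b => (h hn).2.1 b a, (h hn).2.2.2, (h hn).2.2.1⟩
    · unfold SP
      intro x x1 x2 w1 w2 c11 c12 c21 c22 h hn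
      refine ⟨(h hn).1, fun a b => ((h hn).2.1 a b).symm, fun a b => ?_, fun a b => ?_⟩
      · have := (h hn).2.2.1 a b
        exact ⟨this.2.1, this.1, fun h => this.2.2 h.symm⟩
      · have := (h hn).2.2.2 a b
        exact ⟨this.2.1, this.1, fun h => this.2.2 h.symm⟩
    · rintro ⟨u, v, w⟩
      rcases n3 _ _ _ u v w with e | e | e <;> tauto
    · rintro ⟨u, v, w⟩
      rcases n3 _ _ _ u v w with e | e | e <;> tauto
    · rintro ⟨u, v, w⟩
      rcases n3 _ _ _ u v w with e | e | e <;> tauto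
    · rintro ⟨u, v, w⟩
      rcases n3 _ _ _ u v w with e | e | e <;> tauto

/-- Each of `P₄,₁`, `P₄,₃`, `P₄,₅` has threshold sequence `(1, 3, 11, ∞)`: each is a
`(1,1)`-winner, a `(1,2)`-loser, a `(2,3)`-winner, a `(2,4)`-loser, a `(3,11)`-winner,
a `(3,12)`-loser, and an `(n,b)`-winner for every `n ≥ 4` and every `b`. -/
theorem tetrominoes_threshold_1_3_11 :
    (IsWinner P41 1 1 ∧ ¬ IsWinner P41 1 2 ∧
      IsWinner P41 2 3 ∧ ¬ IsWinner P41 2 4 ∧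
      IsWinner P41 3 11 ∧ ¬ IsWinner P41 3 12 ∧
      ∀ n b : ℕ, 4 ≤ n → IsWinner P41 n b) ∧
    (IsWinner P43 1 1 ∧ ¬ IsWinner P43 1 2 ∧
      IsWinner P43 2 3 ∧ ¬ IsWinner P43 2 4 ∧
      IsWinner P43 3 11 ∧ ¬ IsWinner P43 3 12 ∧
      ∀ n b : ℕ, 4 ≤ n → IsWinner P43 n b) ∧
    (IsWinner P45 1 1 ∧ ¬ IsWinner P45 1 2 ∧
      IsWinner P45 2 3 ∧ ¬ IsWinner P45 2 4 ∧
      IsWinner P45 3 11 ∧ ¬ IsWinner P45 3 12 ∧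
      ∀ n b : ℕ, 4 ≤ n → IsWinner P45 n b) := by
  exact ⟨⟨w11I, lI 1 (by norm_num), w23I, lI 2 le_rfl, w311I, l312I,
      fun n b h => winner_four (by decide) n b h⟩,
    ⟨w11T, lT 1 (by norm_num), w23T, lT 2 le_rfl, w311T, l312T,
      fun n b h => winner_four (by decide) n b h⟩,
    ⟨w11S, lS 1 (by norm_num), w23S, lS 2 le_rfl, w311S, l312S,
      fun n b h => winner_four (by decide) n b h⟩⟩
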